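/- arXiv:2412.20513 — 6 statements merged into one kernel-verified Lean document; each statement's English description precedes it below -/
import Mathlib

section
/- Let Ω be a non-bipartite connected finite simple graph with n vertices and m edges, m ≥ n, and let W = B D⁻¹ be its weighted signless edge-vertex incidence matrix. Then the smallest normalized signless ∞-Laplacian eigenvalue satisfies μ_∞(Ω) = min_{‖X‖_∞ = 1} ‖WX‖_∞ = 1 / ( min { ‖G‖_{∞,∞} : G ∈ ℝ^{n×m}, W G W = W } ); in particular the minimum over generalized inverses G is attained. -/
/-- The `(∞,∞)` operator norm of a real matrix: the maximal absolute row sum. -/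
noncomputable def matInfNorm {m n : Type*} [Fintype m] [Fintype n]
    (A : Matrix m n ℝ) : ℝ := ⨆ i, ∑ j, |A i j|

open Matrix in
/-- The absolute row sums of a matrix bound its action on the sup norm. -/
theorem norm_mulVec_le_matInfNorm {m n : Type*} [Fintype m] [Fintype n]
    (A : Matrix m n ℝ) (x : n → ℝ) : ‖A *ᵥ x‖ ≤ matInfNorm A * ‖x‖ := by
  have hrow (i : m) : ∑ j, |A i j| ≤ matInfNorm A :=
    le_ciSup (f := fun i => ∑ j, |A i j|) (Set.finite_range _).bddAbove i
  have hnonneg : 0 ≤ matInfNorm A :=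
    Real.iSup_nonneg fun i => Finset.sum_nonneg fun j _ => abs_nonneg _
  refine (pi_norm_le_iff_of_nonneg (mul_nonneg hnonneg (norm_nonneg x))).2 fun i => ?_
  calc ‖(A *ᵥ x) i‖ ≤ ∑ j, ‖A i j * x j‖ := norm_sum_le _ _
    _ ≤ ∑ j, |A i j| * ‖x‖ := Finset.sum_le_sum fun j _ => by
        rw [norm_mul, Real.norm_eq_abs]
        exact mul_le_mul_of_nonneg_left (norm_le_pi_norm x j) (abs_nonneg _)
    _ = (∑ j, |A i j|) * ‖x‖ := (Finset.sum_mul ..).symm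
    _ ≤ matInfNorm A * ‖x‖ := mul_le_mul_of_nonneg_right (hrow i) (norm_nonneg x)

/-- The dual norm of the sup norm dominates the sum of the absolute coordinates. -/
theorem sum_abs_apply_single_le_norm {n : Type*} [Fintype n] [DecidableEq n]
    (f : StrongDual ℝ (n → ℝ)) : ∑ j, |f (Pi.single j 1)| ≤ ‖f‖ := by
  set s : n → ℝ := fun j => (SignType.sign (f (Pi.single j 1)) : ℝ)
  have hs : ‖s‖ ≤ 1 := (pi_norm_le_iff_of_nonneg zero_le_one).2 fun j => by
    rcases lt_trichotomy (f (Pi.single j 1)) 0 with h | h | h <;> simp [s, h]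
  calc ∑ j, |f (Pi.single j 1)| = f s := by
        conv_rhs => rw [pi_eq_sum_univ' s]
        simp [s, map_sum]
    _ ≤ ‖f s‖ := le_abs_self _
    _ ≤ ‖f‖ * ‖s‖ := f.le_opNorm s
    _ ≤ ‖f‖ := mul_le_of_le_one_right (norm_nonneg f) hs

open Matrix in
/-- By Hahn-Banach, a matrix bounded below in the sup norm by `μ` has a left inverse whose
absolute row sums are at most `μ⁻¹`. -/
theorem exists_leftInverse_matInfNorm_le {m n : Type*} [Fintype m] [Fintype n] [DecidableEq n]
    (A : Matrix m n ℝ) {μ : ℝ} (hμ : 0 < μ) (hA : ∀ x, μ * ‖x‖ ≤ ‖A *ᵥ x‖) :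
    ∃ B : Matrix n m ℝ, B * A = 1 ∧ matInfNorm B ≤ μ⁻¹ := by
  classical
  have hinj : Function.Injective A.mulVecLin := by
    refine (injective_iff_map_eq_zero _).2 fun x hx => ?_
    have h := hA x
    rw [show A *ᵥ x = 0 from hx, norm_zero] at h
    exact norm_le_zero_iff.1 (nonpos_of_mul_nonpos_right h hμ)
  let e := LinearEquiv.ofInjective A.mulVecLin hinj
  have hbound (i : n) (y : LinearMap.range A.mulVecLin) :
      ‖(LinearMap.proj i ∘ₗ e.symm.toLinearMap : _ →ₗ[ℝ] ℝ) y‖ ≤ μ⁻¹ * ‖y‖ := by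
    obtain ⟨x, rfl⟩ := e.surjective y
    have hx : ‖e x‖ = ‖A *ᵥ x‖ := rfl
    simp only [LinearMap.comp_apply, LinearEquiv.coe_coe, LinearEquiv.symm_apply_apply,
      LinearMap.proj_apply, hx]
    rw [le_inv_mul_iff₀ hμ]
    exact (mul_le_mul_of_nonneg_left (norm_le_pi_norm x i) hμ.le).trans (hA x)
  have hext (i : n) : ∃ f : StrongDual ℝ (m → ℝ), (∀ x, f (A *ᵥ x) = x i) ∧ ‖f‖ ≤ μ⁻¹ := by
    obtain ⟨f, hf, hnorm⟩ := exists_extension_norm_eq _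
      (LinearMap.mkContinuous _ μ⁻¹ (hbound i))
    refine ⟨f, fun x => ?_, hnorm.trans_le ?_⟩
    · have := hf (e x)
      simpa [e] using this
    · exact LinearMap.mkContinuous_norm_le _ (inv_nonneg.2 hμ.le) _
  choose f hf hnorm using hext
  refine ⟨of fun i j => f i (Pi.single j 1), ?_, ?_⟩
  · ext i k
    have h := hf i (Pi.single k 1)
    rw [pi_eq_sum_univ' (A *ᵥ Pi.single k 1)] at h
    simp only [map_sum, map_smul, smul_eq_mul, mulVec_single_one, col_apply] at h
    simp [mul_apply, one_apply, mul_comm, h, Pi.single_apply]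
  · exact Real.iSup_le (fun i => (sum_abs_apply_single_le_norm (f i)).trans (hnorm i))
      (inv_nonneg.2 hμ.le)

open Matrix in
/-- For a matrix with trivial kernel, the minimum of `‖A x‖` over the sup-norm unit sphere is the
reciprocal of the least `(∞,∞)` norm of a generalized inverse. -/
theorem exists_isLeast_norm_mulVec_isLeast_matInfNorm {m n : Type*} [Fintype m] [Fintype n]
    [DecidableEq n] [Nonempty n] (A : Matrix m n ℝ) (hker : ∀ x, A *ᵥ x = 0 → x = 0) :
    ∃ μ g : ℝ,
      IsLeast {r : ℝ | ∃ x : n → ℝ, ‖x‖ = 1 ∧ r = ‖A *ᵥ x‖} μ ∧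
      IsLeast {r : ℝ | ∃ B : Matrix n m ℝ, A * B * A = A ∧ r = matInfNorm B} g ∧
      μ = 1 / g := by
  have hcont : Continuous fun x : n → ℝ => ‖A *ᵥ x‖ :=
    (A.mulVecLin.continuous_of_finiteDimensional).norm
  obtain ⟨x₀, hx₀, hmin⟩ := (isCompact_sphere (0 : n → ℝ) 1).exists_isMinOn
    (NormedSpace.sphere_nonempty.2 zero_le_one) hcont.continuousOn
  rw [mem_sphere_zero_iff_norm] at hx₀
  set μ := ‖A *ᵥ x₀‖
  have hμ : 0 < μ := norm_pos_iff.2 fun h => by simp [hker x₀ h] at hx₀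
  have hlower (x : n → ℝ) (hx : ‖x‖ = 1) : μ ≤ ‖A *ᵥ x‖ :=
    hmin (mem_sphere_zero_iff_norm.2 hx)
  have hbelow (x : n → ℝ) : μ * ‖x‖ ≤ ‖A *ᵥ x‖ := by
    rcases eq_or_ne x 0 with rfl | hx
    · simp
    · have hpos := norm_pos_iff.2 hx
      have h := hlower (‖x‖⁻¹ • x) (by rw [norm_smul, norm_inv, norm_norm,
        inv_mul_cancel₀ hpos.ne'])
      rwa [mulVec_smul, norm_smul, norm_inv, norm_norm, le_inv_mul_iff₀ hpos, mul_comm] at h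
  have hgen (B : Matrix n m ℝ) (hB : A * B * A = A) : μ⁻¹ ≤ matInfNorm B := by
    have hleft : B *ᵥ (A *ᵥ x₀) = x₀ := by
      refine sub_eq_zero.1 (hker _ ?_)
      rw [mulVec_sub, mulVec_mulVec, mulVec_mulVec, hB, sub_self]
    have h := norm_mulVec_le_matInfNorm B (A *ᵥ x₀)
    rw [hleft, hx₀] at h
    exact (inv_le_iff_one_le_mul₀ hμ).2 h
  obtain ⟨B, hBA, hBnorm⟩ := exists_leftInverse_matInfNorm_le A hμ hbelow
  have hB : A * B * A = A := by rw [Matrix.mul_assoc, hBA, Matrix.mul_one]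
  refine ⟨μ, μ⁻¹, ⟨⟨x₀, hx₀, rfl⟩, ?_⟩, ⟨⟨B, hB, (hgen B hB).antisymm hBnorm⟩, ?_⟩, by simp⟩
  · rintro _ ⟨x, hx, rfl⟩
    exact hlower x hx
  · rintro _ ⟨C, hC, rfl⟩
    exact hgen C hC

/-- On a connected non-bipartite graph, the only function that changes sign along every edge
is zero. -/
theorem SimpleGraph.Connected.eq_zero_of_adj_add_eq_zero {V : Type*} {G : SimpleGraph V}
    (hconn : G.Connected) (hnotbip : ¬ G.Colorable 2) {y : V → ℝ}
    (hy : ∀ u v, G.Adj u v → y u + y v = 0) : y = 0 := by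
  by_contra hne
  obtain ⟨w, hw⟩ := Function.ne_iff.1 hne
  have hwalk {u v : V} (p : G.Walk u v) : y u ≠ 0 → y v ≠ 0 := by
    induction p with
    | nil => exact id
    | cons h _ ih => exact fun hu => ih fun hv => hu (by linarith [hy _ _ h])
  have hall (v : V) : y v ≠ 0 := (hconn.preconnected w v).elim fun p => hwalk p hw
  refine hnotbip ((SimpleGraph.Coloring.mk (fun v => decide (0 < y v)) ?_ :
    G.Coloring Bool).colorable)
  intro u v h heq
  rw [decide_eq_decide] at heq
  have hsum := hy u v h
  rcases (hall u).lt_or_gt with hu | hu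
  · exact absurd (heq.2 (by linarith)) (by linarith)
  · linarith [heq.1 hu]

/-- Let `Ω` be a non-bipartite connected finite simple graph with `n` vertices and
`m` edges, `m ≥ n`, and let `W = B D⁻¹` be its weighted signless edge-vertex incidence
matrix, i.e. `W e v = 1 / deg v` if `v` is incident to the edge `e` and `0` otherwise.
Then `μ_∞(Ω) = min_{‖X‖_∞ = 1} ‖WX‖_∞ = 1 / min { ‖G‖_{∞,∞} : W G W = W }`;
in particular both minima are attained. -/
theorem stmt0 {V : Type*} [Fintype V] [DecidableEq V]
    (G : SimpleGraph V) [DecidableRel G.Adj]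
    (hconn : G.Connected) (hnotbip : ¬ G.Colorable 2)
    (hmn : Fintype.card V ≤ G.edgeFinset.card)
    (W : Matrix G.edgeSet V ℝ)
    (hW : ∀ (e : G.edgeSet) (v : V),
      W e v = if v ∈ (e : Sym2 V) then ((G.degree v : ℝ))⁻¹ else 0) :
    ∃ μ g : ℝ,
      IsLeast {r : ℝ | ∃ X : V → ℝ, ‖X‖ = 1 ∧ r = ‖W.mulVec X‖} μ ∧
      IsLeast {r : ℝ | ∃ Gi : Matrix V G.edgeSet ℝ, W * Gi * W = W ∧ r = matInfNorm Gi} g ∧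
      μ = 1 / g := by
  have := hconn.nonempty
  refine exists_isLeast_norm_mulVec_isLeast_matInfNorm W fun X hX => ?_
  have hdeg (v : V) : (G.degree v : ℝ) ≠ 0 := by
    have : Nontrivial V := by
      by_contra hV
      rw [not_nontrivial_iff_subsingleton] at hV
      exact hnotbip ⟨SimpleGraph.Coloring.mk (fun _ => 0)
        fun {u v} h => (h.ne (Subsingleton.elim u v)).elim⟩
    exact_mod_cast (hconn.preconnected.degree_pos_of_nontrivial v).ne'
  have hzero : (fun v => (G.degree v : ℝ)⁻¹ * X v) = 0 := by
    refine hconn.eq_zero_of_adj_add_eq_zero hnotbip fun u v h => ?_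
    have hedge : ∑ w, W ⟨s(u, v), h⟩ w * X w = 0 := congrFun hX ⟨s(u, v), h⟩
    rw [← Finset.sum_pair (f := fun w => (G.degree w : ℝ)⁻¹ * X w) h.ne, ← hedge]
    have hpair : ({u, v} : Finset V) = Finset.univ.filter (· ∈ s(u, v)) := by ext; simp
    rw [hpair, Finset.sum_filter]
    exact Finset.sum_congr rfl fun w _ => by rw [hW, ite_mul, zero_mul]
  funext v
  exact (mul_eq_zero.1 (congrFun hzero v)).resolve_left (inv_ne_zero (hdeg v))
end

section
/- Let W be a real m×n matrix with full column rank and set c = min_{‖X‖_∞ = 1} ‖WX‖_∞ > 0. Then there exists a left inverse G ∈ ℝ^{n×m} of W (G W = I_n) with ‖G‖_{∞,∞} = 1/c. -/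
/-- A coordinate functional composed with the inverse of an expanding injective matrix extends to a
functional whose `ℓ¹` norm is at most the reciprocal of the expansion constant. -/
lemma exists_row_of_expanding {m n : Type*} [Fintype m] [Fintype n] (W : Matrix m n ℝ)
    (hW : Function.Injective W.mulVec) {c : ℝ} (hc : 0 < c)
    (h : ∀ X : n → ℝ, c * ‖X‖ ≤ ‖W.mulVec X‖) (i : n) :
    ∃ g : m → ℝ, (∀ X : n → ℝ, g ⬝ᵥ W.mulVec X = X i) ∧ ∑ j, |g j| ≤ 1 / c := by
  classical
  let e := LinearEquiv.ofInjective W.mulVecLin hW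
  let f : (m → ℝ) →ₗ.[ℝ] ℝ := ⟨W.mulVecLin.range, LinearMap.proj i ∘ₗ e.symm.toLinearMap⟩
  have hf : ∀ X : n → ℝ, f (e X) = X i := fun X => by
    change e.symm (e X) i = X i
    rw [e.symm_apply_apply]
  obtain ⟨g, hgf, hg⟩ := exists_extension_of_le_sublinear f (fun y => c⁻¹ * ‖y‖)
    (fun r hr y => by
      simp only [norm_smul, Real.norm_eq_abs, abs_of_pos hr]
      ring)
    (fun x y => by
      rw [← mul_add]
      exact mul_le_mul_of_nonneg_left (norm_add_le x y) (inv_nonneg.2 hc.le))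
    (fun y => by
      obtain ⟨X, rfl⟩ := e.surjective y
      rw [hf, le_inv_mul_iff₀ hc]
      exact (mul_le_mul_of_nonneg_left ((le_abs_self _).trans (norm_le_pi_norm X i)) hc.le).trans
        (h X))
  have hsum : ∀ y : m → ℝ, (fun j => g (Pi.single j 1)) ⬝ᵥ y = g y := fun y => by
    rw [LinearMap.pi_apply_eq_sum_univ g y, dotProduct]
    refine Finset.sum_congr rfl fun j _ => ?_
    rw [smul_eq_mul, mul_comm]
    congr 3
    ext k
    simp [Pi.single_apply, eq_comm]
  refine ⟨fun j => g (Pi.single j 1), fun X => ?_, ?_⟩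
  · rw [hsum]
    exact (hgf (e X)).trans (hf X)
  · have hsign : ‖fun j => (SignType.sign (g (Pi.single j 1)) : ℝ)‖ ≤ 1 := by
      refine (pi_norm_le_iff_of_nonneg zero_le_one).2 fun j => ?_
      cases SignType.sign (g (Pi.single j 1)) <;> simp
    calc ∑ j, |g (Pi.single j 1)|
        = (fun j => g (Pi.single j 1)) ⬝ᵥ
            fun j => (SignType.sign (g (Pi.single j 1)) : ℝ) := by
          simp only [dotProduct, self_mul_sign]
      _ ≤ c⁻¹ * ‖fun j => (SignType.sign (g (Pi.single j 1)) : ℝ)‖ := (hsum _).trans_le (hg _)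
      _ ≤ 1 / c := by
          rw [one_div]
          exact mul_le_of_le_one_right (inv_nonneg.2 hc.le) hsign

/-- Let `W` be a real `m × n` matrix with full column rank and let
`c = min_{‖X‖_∞ = 1} ‖WX‖_∞ > 0`. Then there exists a left inverse `G` of `W`
with `‖G‖_{∞,∞} = 1/c`. -/
theorem stmt3 {m n : ℕ} (W : Matrix (Fin m) (Fin n) ℝ)
    (hW : Function.Injective W.mulVec) (c : ℝ)
    (hc : IsLeast {r : ℝ | ∃ X : Fin n → ℝ, ‖X‖ = 1 ∧ r = ‖W.mulVec X‖} c)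
    (hcpos : 0 < c) :
    ∃ G : Matrix (Fin n) (Fin m) ℝ, G * W = 1 ∧ matInfNorm G = 1 / c := by
  have h : ∀ X : Fin n → ℝ, c * ‖X‖ ≤ ‖W.mulVec X‖ := fun X => by
    rcases eq_or_ne X 0 with rfl | hX
    · simp
    have hX' : 0 < ‖X‖ := norm_pos_iff.2 hX
    have := hc.2 ⟨‖X‖⁻¹ • X, by rw [norm_smul, norm_inv, norm_norm, inv_mul_cancel₀ hX'.ne'], rfl⟩
    rwa [Matrix.mulVec_smul, norm_smul, norm_inv, norm_norm, le_inv_mul_iff₀ hX', mul_comm] at this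
  choose G hG hGc using exists_row_of_expanding W hW hcpos h
  refine ⟨Matrix.of G, ?_, ?_⟩
  · refine Matrix.ext_of_mulVec_single fun k => ?_
    rw [← Matrix.mulVec_mulVec, Matrix.one_mulVec]
    exact funext fun i => hG i _
  · obtain ⟨X, hX, hXc⟩ := hc.1
    have hn : Nonempty (Fin n) := by
      by_contra hn
      rw [not_nonempty_iff] at hn
      simp [Subsingleton.elim X 0] at hX
    refine le_antisymm (ciSup_le hGc) ?_
    rw [div_le_iff₀ hcpos, ← hX]
    have hbdd : BddAbove (Set.range fun i => ∑ j, |Matrix.of G i j|) := (Set.finite_range _).bddAbove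
    refine (pi_norm_le_iff_of_nonempty _).2 fun i => ?_
    calc ‖X i‖ = |∑ j, G i j * W.mulVec X j| := by rw [← hG i X, dotProduct, Real.norm_eq_abs]
      _ ≤ ∑ j, |G i j| * c := by
          refine (Finset.abs_sum_le_sum_abs _ _).trans (Finset.sum_le_sum fun j _ => ?_)
          rw [abs_mul, hXc]
          exact mul_le_mul_of_nonneg_left (norm_le_pi_norm (W.mulVec X) j) (abs_nonneg _)
      _ = (∑ j, |G i j|) * c := (Finset.sum_mul _ _ _).symm
      _ ≤ matInfNorm (Matrix.of G) * c := mul_le_mul_of_nonneg_right (le_ciSup hbdd i) hcpos.le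
end

section
/- Let a, b > 2 be integers with a odd and b odd, n = a + b − 1, and suppose a > 2b. Let W be the weighted signless edge-vertex incidence matrix of the graph ET(n, a, b). Then min { ‖G‖_{∞,∞} : G ∈ ℝ^{n×(n+1)}, W G W = W } = a. -/
/-- The weighted signless edge-vertex incidence matrix `W = B D⁻¹` of the bicyclic graph
`ET(n, a, b)` with `n = a + b - 1` vertices `v_1, …, v_n` and `n + 1 = a + b` edges
`e_1, …, e_{n+1}`, where `e_k` joins `v_k` and `v_{k+1}` for `k = 1, …, a-1`; `e_a` joins
`v_a` and `v_1`; `e_k` joins `v_{k-1}` and `v_k` for `k = a+1, …, n`; and `e_{n+1}` joins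
`v_n` and `v_a`. Rows are indexed by edges (edge `e_k` corresponds to index `k - 1` in
`Fin (a + b)`), columns by vertices (vertex `v_j` corresponds to index `j - 1` in
`Fin (a + b - 1)`); the entry in row `e_k`, column `v_j` is `1 / deg v_j` if `v_j` is
incident to `e_k`, and `0` otherwise (the degree of `v_a` is `4`, all other degrees are `2`). -/
noncomputable def ETW (a b : ℕ) : Matrix (Fin (a + b)) (Fin (a + b - 1)) ℝ :=
  fun k j =>
    let n := a + b - 1
    let K := (k : ℕ) + 1
    let J := (j : ℕ) + 1
    let u : ℕ := if K ≤ a - 1 then K else if K = a then a else if K ≤ n then K - 1 else n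
    let v : ℕ := if K ≤ a - 1 then K + 1 else if K = a then 1 else if K ≤ n then K else a
    if J = u ∨ J = v then (if J = a then (4 : ℝ)⁻¹ else (2 : ℝ)⁻¹) else 0

/-- The value at an edge `k` of the row of an explicit left inverse of `ETW a b`
that belongs to the vertex `i`. -/
noncomputable def leftInvEntry (a i k : ℕ) : ℝ :=
  if i + 1 < a then
    if k < i then -(-1) ^ (k + i) else if k < a then (-1) ^ (k + i) else 0
  else if k < a then 0
  else if i + 1 = a then 2 * (-1) ^ (k + a)
  else if k ≤ i then (-1) ^ (k + i) else -(-1) ^ (k + i)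

theorem ETW_apply (a b : ℕ) (ha : 2 < a) (k : Fin (a + b)) (j : Fin (a + b - 1)) :
    ETW a b k j =
      if (if k + 1 < a then (j : ℕ) = k ∨ (j : ℕ) = k + 1
        else if (k : ℕ) + 1 = a then (j : ℕ) + 1 = a ∨ (j : ℕ) = 0
        else if (k : ℕ) + 1 < a + b then (j : ℕ) + 1 = k ∨ (j : ℕ) = k
        else (j : ℕ) + 1 = k ∨ (j : ℕ) + 1 = a) then
        (if (j : ℕ) + 1 = a then (4 : ℝ)⁻¹ else (2 : ℝ)⁻¹) else 0 := by
  have hk := k.2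
  unfold ETW
  dsimp only
  refine if_congr ?_ rfl rfl
  split_ifs <;> omega

theorem sum_mul_ite_two {N : ℕ} (f : ℕ → ℝ) (c : ℝ) (P : Fin N → Prop) [DecidablePred P]
    (x y : ℕ) (hx : x < N) (hy : y < N) (hxy : x ≠ y)
    (hP : ∀ k : Fin N, P k ↔ (k : ℕ) = x ∨ (k : ℕ) = y) :
    ∑ k : Fin N, f k * (if P k then c else 0) = (f x + f y) * c := by
  have h : ∀ k : Fin N, f k * (if P k then c else 0)
      = (if k = ⟨x, hx⟩ then f x * c else 0) + (if k = ⟨y, hy⟩ then f y * c else 0) := by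
    intro k
    simp only [hP, Fin.ext_iff]
    split_ifs <;> first | (exfalso; omega) | simp_all
  rw [Finset.sum_congr rfl fun k _ => h k, Finset.sum_add_distrib]
  simp
  ring

theorem sum_mul_ite_four {N : ℕ} (f : ℕ → ℝ) (c : ℝ) (P : Fin N → Prop) [DecidablePred P]
    (x y z w : ℕ) (hx : x < y) (hy : y < z) (hz : z < w) (hw : w < N)
    (hP : ∀ k : Fin N, P k ↔ (k : ℕ) = x ∨ (k : ℕ) = y ∨ (k : ℕ) = z ∨ (k : ℕ) = w) :
    ∑ k : Fin N, f k * (if P k then c else 0) = (f x + f y + f z + f w) * c := by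
  classical
  have h : ∀ k : Fin N, f k * (if P k then c else 0)
      = f k * (if (k : ℕ) = x ∨ (k : ℕ) = y then c else 0)
        + f k * (if (k : ℕ) = z ∨ (k : ℕ) = w then c else 0) := by
    intro k
    simp only [hP]
    split_ifs <;> first | (exfalso; omega) | simp
  rw [Finset.sum_congr rfl fun k _ => h k, Finset.sum_add_distrib,
    sum_mul_ite_two f c _ x y (by omega) (by omega) (by omega) fun _ => Iff.rfl,
    sum_mul_ite_two f c _ z w (by omega) (by omega) (by omega) fun _ => Iff.rfl]
  ring

theorem sum_mul_ETW (a b : ℕ) (ha : 2 < a) (hb : 2 < b) (f : ℕ → ℝ) (j : Fin (a + b - 1)) :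
    ∑ k : Fin (a + b), f k * ETW a b k j =
      if (j : ℕ) = 0 then (f 0 + f (a - 1)) * 2⁻¹
      else if (j : ℕ) + 1 < a then (f (j - 1) + f j) * 2⁻¹
      else if (j : ℕ) + 1 = a then (f (a - 2) + f (a - 1) + f a + f (a + b - 1)) * 4⁻¹
      else (f j + f (j + 1)) * 2⁻¹ := by
  simp only [ETW_apply a b ha]
  by_cases h0 : (j : ℕ) = 0
  · simp only [if_pos h0, if_neg (show ¬(j : ℕ) + 1 = a by omega)]
    refine sum_mul_ite_two f _ _ 0 (a - 1) (by omega) (by omega) (by omega) fun k => ?_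
    split_ifs <;> omega
  rw [if_neg h0]
  by_cases h1 : (j : ℕ) + 1 < a
  · simp only [if_pos h1, if_neg h1.ne]
    refine sum_mul_ite_two f _ _ ((j : ℕ) - 1) j (by omega) (by omega) (by omega) fun k => ?_
    split_ifs <;> omega
  rw [if_neg h1]
  by_cases h2 : (j : ℕ) + 1 = a
  · simp only [if_pos h2]
    refine sum_mul_ite_four f _ _ (a - 2) (a - 1) a (a + b - 1) (by omega) (by omega)
      (by omega) (by omega) fun k => ?_
    split_ifs <;> omega
  · simp only [if_neg h2]
    refine sum_mul_ite_two f _ _ j ((j : ℕ) + 1) (by omega) (by omega) (by omega) fun k => ?_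
    split_ifs <;> omega

set_option maxHeartbeats 1000000 in
theorem leftInv_mul_ETW (a b : ℕ) (ha : 2 < a) (hb : 2 < b) (haodd : Odd a) (hbodd : Odd b) :
    (Matrix.of fun (i : Fin (a + b - 1)) (k : Fin (a + b)) => leftInvEntry a i k) * ETW a b
      = 1 := by
  ext ⟨i, hi⟩ ⟨j, hj⟩
  rw [Matrix.mul_apply]
  simp only [Matrix.of_apply]
  rw [sum_mul_ETW a b ha hb (leftInvEntry a i), Matrix.one_apply]
  simp only [Fin.mk.injEq]
  obtain ⟨p, rfl⟩ := haodd
  obtain ⟨q, rfl⟩ := hbodd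
  have heven : ∀ x y : ℕ, (∃ m, y = x + 2 * m) → (-1 : ℝ) ^ y = (-1) ^ x := by
    rintro x y ⟨m, rfl⟩
    simp [pow_add, pow_mul]
  have hodd : ∀ x y : ℕ, (∃ m, y = x + 2 * m + 1) → (-1 : ℝ) ^ y = -(-1) ^ x := by
    rintro x y ⟨m, rfl⟩
    simp [pow_add, pow_mul]
  have hself : ∀ x : ℕ, (∃ m, x = 2 * m) → (-1 : ℝ) ^ x = 1 := by
    rintro x ⟨m, rfl⟩
    simp [pow_mul]
  by_cases h0 : j = 0
  · subst h0
    rw [if_pos rfl]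
    have e := heven (0 + i) (2 * p + 1 - 1 + i) ⟨p, by omega⟩
    unfold leftInvEntry
    split_ifs <;> first | (exfalso; omega) | (subst_vars; norm_num; done) | linarith
  rw [if_neg h0]
  by_cases h1 : j + 1 < 2 * p + 1
  · rw [if_pos h1]
    have e := hodd (j - 1 + i) (j + i) ⟨0, by omega⟩
    have e' : i = j → (-1 : ℝ) ^ (j + i) = 1 := fun h => hself _ ⟨i, by omega⟩
    unfold leftInvEntry
    split_ifs <;> first | (exfalso; omega) | linarith | linarith [e' (by assumption)]
  rw [if_neg h1]
  by_cases h2 : j + 1 = 2 * p + 1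
  · rw [if_pos h2]
    have e := hodd (2 * p + 1 - 2 + i) (2 * p + 1 - 1 + i) ⟨0, by omega⟩
    have e' := heven (2 * p + 1 + i) (2 * p + 1 + (2 * q + 1) - 1 + i) ⟨q, by omega⟩
    have d := hself (2 * p + 1 + (2 * p + 1)) ⟨2 * p + 1, by omega⟩
    have d' := hself (2 * p + 1 + (2 * q + 1) - 1 + (2 * p + 1)) ⟨2 * p + q + 1, by omega⟩
    unfold leftInvEntry
    split_ifs <;> first | (exfalso; omega) | linarith
  · rw [if_neg h2]
    have e := hodd (j + i) (j + 1 + i) ⟨0, by omega⟩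
    have d := hodd (j + (2 * p + 1)) (j + 1 + (2 * p + 1)) ⟨0, by omega⟩
    have e' : i = j → (-1 : ℝ) ^ (j + i) = 1 := fun h => hself _ ⟨i, by omega⟩
    unfold leftInvEntry
    split_ifs <;> first | (exfalso; omega) | linarith | linarith [e' (by assumption)]

theorem sum_abs_leftInvEntry_le (a b i : ℕ) (hab : 2 * b ≤ a) :
    ∑ k : Fin (a + b), |leftInvEntry a i k| ≤ a := by
  have hab' : (2 : ℝ) * b ≤ a := by exact_mod_cast hab
  rw [Fin.sum_univ_eq_sum_range (fun k => |leftInvEntry a i k|), Finset.sum_range_add]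
  by_cases h : i + 1 < a
  · have h1 : ∀ k ∈ Finset.range a, |leftInvEntry a i k| ≤ 1 := by
      intro k _
      unfold leftInvEntry
      split_ifs <;> simp
    have h2 : ∀ k ∈ Finset.range b, |leftInvEntry a i (a + k)| ≤ 0 := by
      intro k _
      unfold leftInvEntry
      split_ifs <;> first | (exfalso; omega) | simp
    have := Finset.sum_le_sum h1
    have := Finset.sum_le_sum h2
    simp only [Finset.sum_const, Finset.card_range, nsmul_eq_mul] at *
    linarith
  · have h1 : ∀ k ∈ Finset.range a, |leftInvEntry a i k| ≤ 0 := by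
      intro k hk
      rw [Finset.mem_range] at hk
      unfold leftInvEntry
      split_ifs; simp
    have h2 : ∀ k ∈ Finset.range b, |leftInvEntry a i (a + k)| ≤ 2 := by
      intro k _
      unfold leftInvEntry
      split_ifs <;> simp [abs_mul]
    have := Finset.sum_le_sum h1
    have := Finset.sum_le_sum h2
    simp only [Finset.sum_const, Finset.card_range, nsmul_eq_mul] at *
    linarith

/-- A vertex potential, scaled by the degrees, whose image under `ETW (2 * m + 3) b` is bounded
by `1` while its entry at the vertex `m` has absolute value `2 * m + 3`. -/
noncomputable def dualPotential (m k : ℕ) : ℝ :=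
  if k ≤ m then (-1) ^ k * (k + 3 / 2)
  else if k ≤ 2 * m + 2 then (-1) ^ k * (2 * m + 3 / 2 - k)
  else -(1 / 2)

theorem ETW_mulVec (a b : ℕ) (ha : 2 < a) (hb : 2 < b) (h : ℕ → ℝ) (k : Fin (a + b)) :
    ∑ j : Fin (a + b - 1), ETW a b k j * (h j * if (j : ℕ) + 1 = a then 4 else 2) =
      if k + 1 < a then h k + h (k + 1)
      else if (k : ℕ) + 1 = a then h (a - 1) + h 0
      else if (k : ℕ) + 1 < a + b then h (k - 1) + h k
      else h (k - 1) + h (a - 1) := by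
  have hk := k.2
  have key : ∀ j : Fin (a + b - 1),
      ETW a b k j * (h j * if (j : ℕ) + 1 = a then 4 else 2) = h j *
      if (if k + 1 < a then (j : ℕ) = k ∨ (j : ℕ) = k + 1
        else if (k : ℕ) + 1 = a then (j : ℕ) + 1 = a ∨ (j : ℕ) = 0
        else if (k : ℕ) + 1 < a + b then (j : ℕ) + 1 = k ∨ (j : ℕ) = k
        else (j : ℕ) + 1 = k ∨ (j : ℕ) + 1 = a) then 1 else 0 := by
    intro j
    rw [ETW_apply a b ha]
    split_ifs <;> ring
  rw [Finset.sum_congr rfl fun j _ => key j]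
  split_ifs with h1 h2 h3
  · rw [sum_mul_ite_two h 1 _ k (k + 1) (by omega) (by omega) (by omega)
      fun j => by omega, mul_one]
  · rw [sum_mul_ite_two h 1 _ (a - 1) 0 (by omega) (by omega) (by omega)
      fun j => by omega, mul_one]
  · rw [sum_mul_ite_two h 1 _ (k - 1) k (by omega) (by omega) (by omega)
      fun j => by omega, mul_one]
  · rw [sum_mul_ite_two h 1 _ (k - 1) (a - 1) (by omega) (by omega) (by omega)
      fun j => by omega, mul_one]

theorem dualPotential_add_succ (m k : ℕ) :
    |dualPotential m k + dualPotential m (k + 1)| ≤ 1 := by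
  unfold dualPotential
  have hs : ((-1 : ℝ) ^ k) = 1 ∨ ((-1 : ℝ) ^ k) = -1 := neg_one_pow_eq_or ℝ k
  rw [pow_succ, abs_le]
  push_cast
  split_ifs with h1 h2 h3 h4 h5 h6 <;> first | (exfalso; omega) | skip
  · rcases hs with hs | hs <;> rw [hs] <;> constructor <;> linarith
  · obtain rfl : k = m := by omega
    rcases hs with hs | hs <;> rw [hs] <;> constructor <;> linarith
  · rcases hs with hs | hs <;> rw [hs] <;> constructor <;> linarith
  · obtain rfl : k = 2 * m + 2 := by omega
    push_cast
    rcases hs with hs | hs <;> rw [hs] <;> constructor <;> linarith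
  · norm_num

theorem abs_ETW_mulVec_dualPotential_le (m b : ℕ) (hb : 2 < b) (k : Fin (2 * m + 3 + b)) :
    |∑ j : Fin (2 * m + 3 + b - 1), ETW (2 * m + 3) b k j *
      (dualPotential m j * if (j : ℕ) + 1 = 2 * m + 3 then 4 else 2)| ≤ 1 := by
  have hlast : ∀ k, 2 * m + 2 ≤ k → dualPotential m k = -(1 / 2) := by
    intro k hk
    unfold dualPotential
    split_ifs with h1 h2
    · omega
    · obtain rfl : k = 2 * m + 2 := by omega
      rw [show 2 * m + 2 = 2 * (m + 1) by ring, pow_mul]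
      push_cast
      norm_num
      ring
    · rfl
  have h0 : dualPotential m 0 = 3 / 2 := by simp [dualPotential]
  rw [ETW_mulVec _ b (by omega) hb]
  split_ifs with h1 h2 h3
  · exact dualPotential_add_succ m k
  · rw [hlast _ (by omega), h0]
    norm_num
  · rw [hlast _ (by omega), hlast _ (by omega)]
    norm_num
  · rw [hlast _ (by omega), hlast _ (by omega)]
    norm_num

theorem le_matInfNorm_of_mul_ETW_eq_one (m b : ℕ) (hb : 2 < b)
    (G : Matrix (Fin (2 * m + 3 + b - 1)) (Fin (2 * m + 3 + b)) ℝ)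
    (hG : G * ETW (2 * m + 3) b = 1) : ((2 * m + 3 : ℕ) : ℝ) ≤ matInfNorm G := by
  set z : Fin (2 * m + 3 + b - 1) → ℝ := fun j =>
    dualPotential m j * if (j : ℕ) + 1 = 2 * m + 3 then 4 else 2 with hz
  let i : Fin (2 * m + 3 + b - 1) := ⟨m, by omega⟩
  have hzi : |z i| = ((2 * m + 3 : ℕ) : ℝ) := by
    simp only [hz, i, dualPotential, le_refl, if_true]
    rw [if_neg (by omega), abs_mul, abs_mul, abs_neg_one_pow, abs_of_nonneg (by positivity)]
    push_cast
    norm_num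
    ring
  have hsum : z i = ∑ k, G i k * ∑ j, ETW (2 * m + 3) b k j * z j := by
    have h1 : (G * ETW (2 * m + 3) b).mulVec z = z := by rw [hG, Matrix.one_mulVec]
    rw [← Matrix.mulVec_mulVec] at h1
    exact (congrFun h1 i).symm
  calc ((2 * m + 3 : ℕ) : ℝ) = |∑ k, G i k * ∑ j, ETW (2 * m + 3) b k j * z j| := by
        rw [← hsum, hzi]
    _ ≤ ∑ k, |G i k * ∑ j, ETW (2 * m + 3) b k j * z j| := Finset.abs_sum_le_sum_abs _ _
    _ ≤ ∑ k, |G i k| := by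
        refine Finset.sum_le_sum fun k _ => ?_
        rw [abs_mul]
        exact mul_le_of_le_one_right (abs_nonneg _) (abs_ETW_mulVec_dualPotential_le m b hb k)
    _ ≤ matInfNorm G := le_ciSup (f := fun i => ∑ k, |G i k|) (Set.finite_range _).bddAbove i

/-- If `a, b > 2` are odd integers with `a > 2b`, then the minimal `(∞,∞)`-norm of a
generalized inverse of the weighted signless incidence matrix `W` of `ET(n, a, b)` is `a`. -/
theorem stmt6 (a b : ℕ) (ha : 2 < a) (hb : 2 < b) (haodd : Odd a) (hbodd : Odd b)
    (hab : 2 * b < a) :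
    IsLeast {r : ℝ | ∃ G : Matrix (Fin (a + b - 1)) (Fin (a + b)) ℝ,
      ETW a b * G * ETW a b = ETW a b ∧ r = matInfNorm G} (a : ℝ) := by
  have hL := leftInv_mul_ETW a b ha hb haodd hbodd
  set L : Matrix (Fin (a + b - 1)) (Fin (a + b)) ℝ :=
    Matrix.of fun i k => leftInvEntry a i k with hLdef
  have hlow : ∀ G : Matrix (Fin (a + b - 1)) (Fin (a + b)) ℝ,
      G * ETW a b = 1 → (a : ℝ) ≤ matInfNorm G := by
    obtain ⟨m, rfl⟩ : ∃ m, a = 2 * m + 3 := by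
      obtain ⟨p, rfl⟩ := haodd
      exact ⟨p - 1, by omega⟩
    exact le_matInfNorm_of_mul_ETW_eq_one m b hb
  refine ⟨⟨L, ?_, le_antisymm (hlow L hL) ?_⟩, ?_⟩
  · rw [Matrix.mul_assoc, hL, Matrix.mul_one]
  · have : Nonempty (Fin (a + b - 1)) := ⟨⟨0, by omega⟩⟩
    exact ciSup_le fun i => sum_abs_leftInvEntry_le a b i hab.le
  · rintro _ ⟨G, hG, rfl⟩
    refine hlow G ?_
    calc G * ETW a b = L * ETW a b * (G * ETW a b) := by rw [hL, Matrix.one_mul]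
      _ = L * (ETW a b * G * ETW a b) := by simp only [Matrix.mul_assoc]
      _ = 1 := by rw [hG, hL]
end

section
/- Let a, b > 2 be integers with a odd and b odd, n = a + b − 1, and suppose a ≤ 2b and b ≤ 2a. Let W be the weighted signless edge-vertex incidence matrix of the graph ET(n, a, b). Then min { ‖G‖_{∞,∞} : G ∈ ℝ^{n×(n+1)}, W G W = W } = 2·min{a, b}. -/
/-- The alternating sign `(-1) ^ k`. -/
noncomputable def altSign (k : ℕ) : ℝ := if k % 2 = 0 then 1 else -1

lemma abs_altSign (k : ℕ) : |altSign k| = 1 := by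
  unfold altSign; split_ifs <;> norm_num

lemma altSign_succ (k : ℕ) : altSign (k + 1) = -altSign k := by
  unfold altSign; split_ifs <;> first | omega | norm_num

/-- The size of the entries of row `i` of `ETLeftInv` on the edges of the first cycle. -/
noncomputable def ETCoeffA (a b i : ℕ) : ℝ :=
  if i + 1 < a then 1 else if i + 1 = a ∧ a ≤ b then 2 else 0

/-- The size of the entries of row `i` of `ETLeftInv` on the edges of the second cycle. -/
noncomputable def ETCoeffB (a b i : ℕ) : ℝ :=
  if a ≤ i then 1 else if i + 1 = a ∧ b < a then 2 else 0

/-- A left inverse of `ETW a b` for odd `a` and `b`: each row alternates in sign along one of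
the two cycles, and the row of the common vertex uses the shorter one. -/
noncomputable def ETLeftInv (a b : ℕ) : Matrix (Fin (a + b - 1)) (Fin (a + b)) ℝ :=
  fun i k =>
    if (k : ℕ) < a then
      ETCoeffA a b i * (if (k : ℕ) < i then altSign (i + k + 1) else altSign (i + k))
    else
      ETCoeffB a b i * (if (k : ℕ) ≤ i then altSign (i + k) else altSign (i + k + 1))

lemma ETCoeffA_nonneg (a b i : ℕ) : 0 ≤ ETCoeffA a b i := by
  unfold ETCoeffA; split_ifs <;> norm_num

lemma ETCoeffB_nonneg (a b i : ℕ) : 0 ≤ ETCoeffB a b i := by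
  unfold ETCoeffB; split_ifs <;> norm_num

lemma sum_abs_ETLeftInv (a b : ℕ) (i : Fin (a + b - 1)) :
    ∑ k, |ETLeftInv a b i k| = a * ETCoeffA a b i + b * ETCoeffB a b i := by
  have h : ∀ k, |ETLeftInv a b i k| =
      if (k : ℕ) < a then ETCoeffA a b i else ETCoeffB a b i := by
    intro k
    unfold ETLeftInv
    split_ifs <;>
      simp [abs_mul, abs_altSign, abs_of_nonneg, ETCoeffA_nonneg, ETCoeffB_nonneg]
  simp [h, Fin.sum_univ_add]

/-- The column of a vertex of the first cycle other than the common one. -/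
lemma sum_mul_ETW_left {a b : ℕ} (hb : 2 < b) (g : Fin (a + b) → ℝ)
    (j : Fin (a + b - 1)) (hj : (j : ℕ) + 1 < a) :
    ∑ k, g k * ETW a b k j =
      (g ⟨j, by omega⟩ + g ⟨if (j : ℕ) = 0 then a - 1 else j - 1, by split_ifs <;> omega⟩) / 2 := by
  have h : ∀ k, g k * ETW a b k j =
      (if k = ⟨j, by omega⟩ then g k / 2 else 0) +
      (if k = ⟨if (j : ℕ) = 0 then a - 1 else j - 1, by split_ifs <;> omega⟩
        then g k / 2 else 0) := by
    intro k
    have hk := k.2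
    simp only [ETW, Fin.ext_iff]
    split_ifs <;> first | omega | ring
  simp only [h, Finset.sum_add_distrib, Finset.sum_ite_eq', Finset.mem_univ, if_true]
  ring

/-- The column of a vertex of the second cycle other than the common one. -/
lemma sum_mul_ETW_right {a b : ℕ} (ha : 2 < a) (g : Fin (a + b) → ℝ)
    (j : Fin (a + b - 1)) (hj : a ≤ (j : ℕ)) :
    ∑ k, g k * ETW a b k j = (g ⟨j, by omega⟩ + g ⟨j + 1, by omega⟩) / 2 := by
  have h : ∀ k, g k * ETW a b k j =
      (if k = ⟨j, by omega⟩ then g k / 2 else 0) +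
      (if k = ⟨j + 1, by omega⟩ then g k / 2 else 0) := by
    intro k
    have hk := k.2
    have hj2 := j.2
    simp only [ETW, Fin.ext_iff]
    split_ifs <;> first | omega | ring
  simp only [h, Finset.sum_add_distrib, Finset.sum_ite_eq', Finset.mem_univ, if_true]
  ring

/-- The column of the common vertex. -/
lemma sum_mul_ETW_center {a b : ℕ} (ha : 2 < a) (hb : 2 < b) (g : Fin (a + b) → ℝ)
    (j : Fin (a + b - 1)) (hj : (j : ℕ) + 1 = a) :
    ∑ k, g k * ETW a b k j =
      (g ⟨a - 2, by omega⟩ + g ⟨a - 1, by omega⟩ + g ⟨a, by omega⟩ +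
        g ⟨a + b - 1, by omega⟩) / 4 := by
  have h : ∀ k, g k * ETW a b k j =
      (if k = ⟨a - 2, by omega⟩ then g k / 4 else 0) +
      (if k = ⟨a - 1, by omega⟩ then g k / 4 else 0) +
      (if k = ⟨a, by omega⟩ then g k / 4 else 0) +
      (if k = ⟨a + b - 1, by omega⟩ then g k / 4 else 0) := by
    intro k
    have hk := k.2
    simp only [ETW, Fin.ext_iff]
    split_ifs <;> first | omega | ring
  simp only [h, Finset.sum_add_distrib, Finset.sum_ite_eq', Finset.mem_univ, if_true]
  ring

lemma ETLeftInv_apply_of_lt {a b : ℕ} (i : Fin (a + b - 1)) {k : ℕ} (hk : k < a + b)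
    (h : k < a) : ETLeftInv a b i ⟨k, hk⟩ =
      ETCoeffA a b i * (if k < i then altSign (i + k + 1) else altSign (i + k)) :=
  if_pos h

lemma ETLeftInv_apply_of_ge {a b : ℕ} (i : Fin (a + b - 1)) {k : ℕ} (hk : k < a + b)
    (h : a ≤ k) : ETLeftInv a b i ⟨k, hk⟩ =
      ETCoeffB a b i * (if k ≤ i then altSign (i + k) else altSign (i + k + 1)) :=
  if_neg h.not_gt

lemma ETLeftInv_mul_ETW {a b : ℕ} (ha : 2 < a) (hb : 2 < b) (haodd : Odd a) (hbodd : Odd b) :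
    ETLeftInv a b * ETW a b = 1 := by
  rw [Nat.odd_iff] at haodd hbodd
  ext i j
  have hi := i.2
  have hj2 := j.2
  simp only [Matrix.mul_apply, Matrix.one_apply, Fin.ext_iff]
  rcases lt_trichotomy ((j : ℕ) + 1) a with hj | hj | hj
  · rw [sum_mul_ETW_left hb _ _ hj, ETLeftInv_apply_of_lt _ _ (by omega),
      ETLeftInv_apply_of_lt _ _ (by split_ifs <;> omega)]
    simp only [ETCoeffA, altSign]
    split_ifs <;> first | omega | norm_num
  · rw [sum_mul_ETW_center ha hb _ _ hj, ETLeftInv_apply_of_lt _ _ (by omega),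
      ETLeftInv_apply_of_lt _ _ (by omega), ETLeftInv_apply_of_ge _ _ (by omega),
      ETLeftInv_apply_of_ge _ _ (by omega)]
    have hA : (if a - 2 < (i : ℕ) then altSign (i + (a - 2) + 1) else altSign (i + (a - 2))) +
        (if a - 1 < (i : ℕ) then altSign (i + (a - 1) + 1) else altSign (i + (a - 1))) =
        if (i : ℕ) + 1 = a then 2 else 0 := by
      simp only [altSign]
      split_ifs <;> first | omega | norm_num
    have hB : (if a ≤ (i : ℕ) then altSign (i + a) else altSign (i + a + 1)) +
        (if a + b - 1 ≤ (i : ℕ) then altSign (i + (a + b - 1))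
          else altSign (i + (a + b - 1) + 1)) =
        if (i : ℕ) + 1 = a then 2 else if a ≤ (i : ℕ) then 0 else 2 * altSign (i + a + 1) := by
      simp only [altSign]
      split_ifs <;> first | omega | norm_num
    rw [← mul_add, hA, add_assoc, ← mul_add, hB]
    simp only [ETCoeffA, ETCoeffB]
    split_ifs <;> first | omega | norm_num
  · rw [sum_mul_ETW_right ha _ _ (by omega), ETLeftInv_apply_of_ge _ _ (by omega),
      ETLeftInv_apply_of_ge _ _ (by omega)]
    simp only [ETCoeffB, altSign]
    split_ifs <;> first | omega | norm_num

/-- The potential along a cycle of length `l` at distance `p` from the common vertex. -/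
noncomputable def cyclePotential (m : ℝ) (l p : ℕ) : ℝ := altSign p * (m * (1 / 2 - p / l))

lemma abs_cyclePotential_add {m : ℝ} {l : ℕ} (hm : 0 ≤ m) (hml : m ≤ l) (hl : 0 < l) (p : ℕ) :
    |cyclePotential m l p + cyclePotential m l (p + 1)| ≤ 1 := by
  have hl' : (0 : ℝ) < l := by exact_mod_cast hl
  have h : cyclePotential m l p + cyclePotential m l (p + 1) = altSign p * (m / l) := by
    unfold cyclePotential
    rw [altSign_succ]
    push_cast
    field_simp
    ring
  rw [h, abs_mul, abs_altSign, one_mul, abs_of_nonneg (by positivity)]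
  exact (div_le_one hl').2 hml

lemma cyclePotential_zero (m : ℝ) (l : ℕ) : cyclePotential m l 0 = m / 2 := by
  simp [cyclePotential, altSign]; ring

lemma cyclePotential_self (m : ℝ) {l : ℕ} (hl : Odd l) : cyclePotential m l l = m / 2 := by
  have h0 : (l : ℝ) ≠ 0 := by exact_mod_cast hl.pos.ne'
  rw [Nat.odd_iff] at hl
  simp only [cyclePotential, altSign, hl, div_self h0]
  norm_num; ring

/-- The dual vector certifying the lower bound for the row of the common vertex. -/
noncomputable def ETDual (a b : ℕ) (j : Fin (a + b - 1)) : ℝ :=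
  if (j : ℕ) + 1 < a then 2 * cyclePotential (min a b) a (j + 1)
  else if (j : ℕ) + 1 = a then 2 * min a b
  else 2 * cyclePotential (min a b) b (j + 1 - a)

/-- The value of `ETW a b *ᵥ y` at the edge `k` with endpoints `u` and `v`. -/
lemma sum_ETW_mul {a b : ℕ} (ha : 2 < a) (hb : 2 < b) (y : Fin (a + b - 1) → ℝ)
    (k : Fin (a + b)) (u v : Fin (a + b - 1))
    (hu : (u : ℕ) = if (k : ℕ) < a then (k : ℕ) else k - 1)
    (hv : (v : ℕ) = if (k : ℕ) + 1 < a then (k : ℕ) + 1 else if (k : ℕ) + 1 = a then 0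
      else if (k : ℕ) + 1 < a + b then (k : ℕ) else a - 1) :
    ∑ j, ETW a b k j * y j =
      (if (u : ℕ) + 1 = a then y u / 4 else y u / 2) +
      (if (v : ℕ) + 1 = a then y v / 4 else y v / 2) := by
  have h : ∀ j, ETW a b k j * y j =
      (if j = u then (if (j : ℕ) + 1 = a then y j / 4 else y j / 2) else 0) +
      (if j = v then (if (j : ℕ) + 1 = a then y j / 4 else y j / 2) else 0) := by
    intro j
    have hk := k.2
    have hj := j.2
    simp only [ETW, Fin.ext_iff]
    split_ifs at hu hv ⊢ <;> first | omega | ring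
  simp only [h, Finset.sum_add_distrib, Finset.sum_ite_eq', Finset.mem_univ, if_true]

lemma ETDual_weighted {a b : ℕ} (j : Fin (a + b - 1)) :
    (if (j : ℕ) + 1 = a then ETDual a b j / 4 else ETDual a b j / 2) =
      if (j : ℕ) + 1 ≤ a then
        (if (j : ℕ) + 1 = a then (min a b : ℝ) / 2 else cyclePotential (min a b) a (j + 1))
      else cyclePotential (min a b) b (j + 1 - a) := by
  unfold ETDual
  push_cast
  split_ifs <;> first | omega | ring

lemma abs_sum_ETW_mul_ETDual_le_one {a b : ℕ} (ha : 2 < a) (hb : 2 < b) (haodd : Odd a)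
    (hbodd : Odd b) (k : Fin (a + b)) : |∑ j, ETW a b k j * ETDual a b j| ≤ 1 := by
  have hk := k.2
  have hm : (0 : ℝ) ≤ min (a : ℝ) b := by positivity
  have hA := abs_cyclePotential_add hm (min_le_left _ _) (by omega : 0 < a)
  have hB := abs_cyclePotential_add hm (min_le_right _ _) (by omega : 0 < b)
  have hA0 := cyclePotential_zero (min (a : ℝ) b) a
  have hB0 := cyclePotential_zero (min (a : ℝ) b) b
  have hAa := cyclePotential_self (min (a : ℝ) b) haodd
  have hBb := cyclePotential_self (min (a : ℝ) b) hbodd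
  rw [sum_ETW_mul ha hb _ k ⟨if (k : ℕ) < a then (k : ℕ) else k - 1, by split_ifs <;> omega⟩
    ⟨if (k : ℕ) + 1 < a then (k : ℕ) + 1 else if (k : ℕ) + 1 = a then 0
      else if (k : ℕ) + 1 < a + b then (k : ℕ) else a - 1, by split_ifs <;> omega⟩ rfl rfl,
    ETDual_weighted, ETDual_weighted]
  dsimp only
  have cases_k : (k : ℕ) + 2 < a ∨ (k : ℕ) + 2 = a ∨ (k : ℕ) + 1 = a ∨ (k : ℕ) = a ∨
      (a < k ∧ (k : ℕ) + 1 < a + b) ∨ (k : ℕ) + 1 = a + b := by omega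
  rcases cases_k with h | h | h | h | ⟨h, h'⟩ | h
  · convert hA (k + 1) using 3 <;> split_ifs <;> first | omega | rfl
  · convert hA (k + 1) using 3
    · split_ifs <;> first | omega | rfl
    · rw [show (k : ℕ) + 1 + 1 = a by omega, hAa]
      split_ifs <;> first | omega | rfl
  · convert hA 0 using 3
    · rw [hA0]
      split_ifs <;> first | omega | rfl
    · split_ifs <;> first | omega | rfl
  · convert hB 0 using 3
    · rw [hB0]
      split_ifs <;> first | omega | rfl
    · split_ifs <;> first | omega | (congr 1; omega)
  · convert hB (k - a) using 3 <;> split_ifs <;> first | omega | (congr 1; omega)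
  · convert hB (k - a) using 3
    · split_ifs <;> first | omega | (congr 1; omega)
    · rw [show (k : ℕ) - a + 1 = b by omega, hBb]
      split_ifs <;> first | omega | rfl

theorem le_matInfNorm_of_mul_ETW {a b : ℕ} (ha : 2 < a) (hb : 2 < b) (haodd : Odd a)
    (hbodd : Odd b) (G : Matrix (Fin (a + b - 1)) (Fin (a + b)) ℝ) (hG : G * ETW a b = 1) :
    ((2 * min a b : ℕ) : ℝ) ≤ matInfNorm G := by
  let c : Fin (a + b - 1) := ⟨a - 1, by omega⟩
  have hc : ETDual a b c = ((2 * min a b : ℕ) : ℝ) := by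
    have h : a - 1 + 1 = a := by omega
    simp [ETDual, c, h]
  calc ((2 * min a b : ℕ) : ℝ) = ((G * ETW a b).mulVec (ETDual a b)) c := by
        rw [hG, Matrix.one_mulVec, hc]
    _ = ∑ k, G c k * ∑ j, ETW a b k j * ETDual a b j := by
        rw [← Matrix.mulVec_mulVec]; rfl
    _ ≤ ∑ k, |G c k| := by
        refine Finset.sum_le_sum fun k _ => (le_abs_self _).trans ?_
        rw [abs_mul]
        exact mul_le_of_le_one_right (abs_nonneg _)
          (abs_sum_ETW_mul_ETDual_le_one ha hb haodd hbodd k)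
    _ ≤ matInfNorm G := le_ciSup (f := fun i => ∑ k, |G i k|) (Set.finite_range _).bddAbove c

/-- If `a, b > 2` are odd integers with `a ≤ 2b` and `b ≤ 2a`, then the minimal
`(∞,∞)`-norm of a generalized inverse of the weighted signless incidence matrix `W` of
`ET(n, a, b)` is `2 · min{a, b}`. -/
theorem stmt7 (a b : ℕ) (ha : 2 < a) (hb : 2 < b) (haodd : Odd a) (hbodd : Odd b)
    (hab : a ≤ 2 * b) (hba : b ≤ 2 * a) :
    IsLeast {r : ℝ | ∃ G : Matrix (Fin (a + b - 1)) (Fin (a + b)) ℝ,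
      ETW a b * G * ETW a b = ETW a b ∧ r = matInfNorm G} ((2 * min a b : ℕ) : ℝ) := by
  have hinv := ETLeftInv_mul_ETW ha hb haodd hbodd
  constructor
  · refine ⟨ETLeftInv a b, by rw [Matrix.mul_assoc, hinv, Matrix.mul_one], ?_⟩
    refine le_antisymm (le_matInfNorm_of_mul_ETW ha hb haodd hbodd _ hinv) ?_
    have : Nonempty (Fin (a + b - 1)) := ⟨⟨0, by omega⟩⟩
    refine ciSup_le fun i => ?_
    rw [sum_abs_ETLeftInv]
    unfold ETCoeffA ETCoeffB
    split_ifs <;> first | omega | (norm_num; norm_cast; omega)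
  · rintro r ⟨G, hG, rfl⟩
    refine le_matInfNorm_of_mul_ETW ha hb haodd hbodd G ?_
    calc G * ETW a b = ETLeftInv a b * ETW a b * (G * ETW a b) := by rw [hinv, Matrix.one_mul]
      _ = ETLeftInv a b * (ETW a b * G * ETW a b) := by simp only [Matrix.mul_assoc]
      _ = 1 := by rw [hG, hinv]
end

section
/- Let a, b > 2 be integers with a and b both odd, n = a + b − 1, and suppose a > 2b. Let W be the weighted signless edge-vertex incidence matrix of ET(n, a, b) and define Y ∈ ℝ^n by y_i = (−1)^i · (a − 2·|(a−1)/2 − i|) for i = 1,…,a−1; y_a = 2; and y_i = (−1)^i · (b − 2·|a + (b+1)/2 − i|) for i = a+1,…,a+b−1. Then ‖Y‖_∞ = a, ‖WY‖_∞ = 1, and hence μ_∞(ET(n,a,b)) = min_{‖X‖_∞=1} ‖WX‖_∞ = 1/a. -/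
/-- The optimal vector `Y` for `ET(n, a, b)` with `a, b` odd and `a > 2b`:
`y_i = (−1)^i (a − 2|(a−1)/2 − i|)` for `i = 1, …, a−1`; `y_a = 2`; and
`y_i = (−1)^i (b − 2|a + (b+1)/2 − i|)` for `i = a+1, …, a+b−1`
(vertex `v_i` corresponds to index `i − 1` in `Fin (a + b - 1)`). -/
noncomputable def Yvec13 (a b : ℕ) : Fin (a + b - 1) → ℝ := fun j =>
  let i : ℤ := (j : ℕ) + 1
  if i ≤ (a : ℤ) - 1 then
    (-1 : ℝ) ^ ((j : ℕ) + 1) * ((((a : ℤ) - 2 * |((a : ℤ) - 1) / 2 - i| : ℤ)) : ℝ)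
  else if i = (a : ℤ) then 2
  else (-1 : ℝ) ^ ((j : ℕ) + 1) * ((((b : ℤ) - 2 * |(a : ℤ) + ((b : ℤ) + 1) / 2 - i| : ℤ)) : ℝ)

/-- The weighted coordinate `x_i / d_i` of `X` at the vertex `v_i` (and `0` if there is no such
vertex). -/
noncomputable def weightedCoord (a n : ℕ) (X : Fin n → ℝ) (i : ℕ) : ℝ :=
  ∑ j : Fin n, if (j : ℕ) + 1 = i then (if (j : ℕ) + 1 = a then (4 : ℝ)⁻¹ else 2⁻¹) * X j else 0

theorem weightedCoord_succ (a n : ℕ) (X : Fin n → ℝ) (j : Fin n) :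
    weightedCoord a n X (j + 1) = (if (j : ℕ) + 1 = a then (4 : ℝ)⁻¹ else 2⁻¹) * X j := by
  unfold weightedCoord
  rw [Finset.sum_eq_single j]
  · simp
  · intro i _ hij
    rw [if_neg]
    simpa [Fin.ext_iff] using hij
  · simp

theorem sum_ite_or_eq_weightedCoord_add (a n : ℕ) (X : Fin n → ℝ) {u v : ℕ} (huv : u ≠ v) :
    ∑ j : Fin n, (if (j : ℕ) + 1 = u ∨ (j : ℕ) + 1 = v then
      (if (j : ℕ) + 1 = a then (4 : ℝ)⁻¹ else 2⁻¹) else 0) * X j =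
      weightedCoord a n X u + weightedCoord a n X v := by
  unfold weightedCoord
  rw [← Finset.sum_add_distrib]
  refine Finset.sum_congr rfl fun j _ => ?_
  by_cases hu : (j : ℕ) + 1 = u
  · simp [hu, huv]
  · by_cases hv : (j : ℕ) + 1 = v
    · simp [hv, huv.symm]
    · simp [hu, hv]

/-- A property holds at every entry of `W X` iff it holds along the edges of both cycles. -/
theorem forall_ETW_mulVec_iff {a b : ℕ} (ha : 2 < a) (hb : 2 < b) (X : Fin (a + b - 1) → ℝ)
    (P : ℝ → Prop) :
    (∀ k, P ((ETW a b).mulVec X k)) ↔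
      let z := weightedCoord a (a + b - 1) X
      (∀ i, 1 ≤ i → i < a → P (z i + z (i + 1))) ∧ P (z a + z 1) ∧
        (∀ i, a ≤ i → i + 1 < a + b → P (z i + z (i + 1))) ∧ P (z (a + b - 1) + z a) := by
  extract_lets z
  have path₁ (k : Fin (a + b)) (h : (k : ℕ) + 1 < a) :
      (ETW a b).mulVec X k = z (k + 1) + z (k + 1 + 1) := by
    rw [← sum_ite_or_eq_weightedCoord_add _ _ _ (by omega)]
    simp only [Matrix.mulVec, dotProduct, ETW, if_pos (show (k : ℕ) + 1 ≤ a - 1 by omega)]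
  have close₁ (k : Fin (a + b)) (h : (k : ℕ) + 1 = a) :
      (ETW a b).mulVec X k = z a + z 1 := by
    rw [← sum_ite_or_eq_weightedCoord_add _ _ _ (by omega)]
    simp only [Matrix.mulVec, dotProduct, ETW, if_neg (show ¬ (k : ℕ) + 1 ≤ a - 1 by omega),
      if_pos h]
  have path₂ (k : Fin (a + b)) (h : a ≤ k) (h' : (k : ℕ) + 1 < a + b) :
      (ETW a b).mulVec X k = z k + z (k + 1) := by
    rw [← sum_ite_or_eq_weightedCoord_add _ _ _ (by omega)]
    simp only [Matrix.mulVec, dotProduct, ETW, if_neg (show ¬ (k : ℕ) + 1 ≤ a - 1 by omega),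
      if_neg (show ¬ (k : ℕ) + 1 = a by omega), if_pos (show (k : ℕ) + 1 ≤ a + b - 1 by omega),
      Nat.add_sub_cancel]
  have close₂ (k : Fin (a + b)) (h : (k : ℕ) + 1 = a + b) :
      (ETW a b).mulVec X k = z (a + b - 1) + z a := by
    rw [← sum_ite_or_eq_weightedCoord_add _ _ _ (by omega)]
    simp only [Matrix.mulVec, dotProduct, ETW, if_neg (show ¬ (k : ℕ) + 1 ≤ a - 1 by omega),
      if_neg (show ¬ (k : ℕ) + 1 = a by omega), if_neg (show ¬ (k : ℕ) + 1 ≤ a + b - 1 by omega)]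
  constructor
  · intro H
    refine ⟨fun i hi hia => ?_, ?_, fun i hi hib => ?_, ?_⟩
    · obtain ⟨j, rfl⟩ := Nat.exists_eq_add_of_le' hi
      simpa only [path₁ ⟨j, by omega⟩ hia] using H ⟨j, by omega⟩
    · have := H ⟨a - 1, by omega⟩
      rwa [close₁ _ (show a - 1 + 1 = a by omega)] at this
    · simpa only [path₂ ⟨i, by omega⟩ hi hib] using H ⟨i, by omega⟩
    · have := H ⟨a + b - 1, by omega⟩
      rwa [close₂ _ (show a + b - 1 + 1 = a + b by omega)] at this
  · rintro ⟨h₁, h₂, h₃, h₄⟩ k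
    rcases lt_trichotomy ((k : ℕ) + 1) a with h | h | h
    · rw [path₁ k h]
      exact h₁ _ (by omega) h
    · rwa [close₁ k h]
    · rcases Nat.lt_or_ge ((k : ℕ) + 1) (a + b) with h' | h'
      · rw [path₂ k (by omega) h']
        exact h₃ _ (by omega) h'
      · rwa [close₂ k (by omega)]

theorem abs_add_sub_neg_one_pow_mul_le {f : ℕ → ℝ} {m : ℝ} (i : ℕ) (l : ℕ)
    (h : ∀ j, i ≤ j → j < i + l → |f j + f (j + 1)| ≤ m) :
    |f (i + l) - (-1) ^ l * f i| ≤ l * m := by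
  induction l with
  | zero => simp
  | succ l ih =>
    have h₁ := abs_le.1 (ih fun j hj hjl => h j hj (by omega))
    have h₂ := abs_le.1 (h (i + l) (by omega) (by omega))
    rw [← add_assoc, pow_succ]
    push_cast
    rw [abs_le]
    constructor <;> linarith

/-- Around an odd closed walk of length `l`, a function is bounded by `l / 2` times the largest
absolute value of its sums over the edges. -/
theorem two_mul_abs_le_of_odd_cycle {f : ℕ → ℝ} {m : ℝ} {l : ℕ} (hl : Odd l) (hf : f l = f 0)
    (h : ∀ j < l, |f j + f (j + 1)| ≤ m) {i : ℕ} (hi : i ≤ l) : 2 * |f i| ≤ l * m := by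
  obtain ⟨r, rfl⟩ := Nat.exists_eq_add_of_le hi
  have h₁ := abs_le.1 (abs_add_sub_neg_one_pow_mul_le 0 i fun j _ hj => h j (by omega))
  have h₂ := abs_le.1 (abs_add_sub_neg_one_pow_mul_le i r fun j _ hj => h j hj)
  rw [hf] at h₂
  rw [zero_add] at h₁
  rw [← abs_two, ← abs_mul, abs_le]
  push_cast
  rcases Nat.even_or_odd i with hi' | hi'
  · have hr : Odd r := by grind
    rw [hi'.neg_one_pow] at h₁
    rw [hr.neg_one_pow] at h₂
    constructor <;> linarith
  · have hr : Even r := by grind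
    rw [hi'.neg_one_pow] at h₁
    rw [hr.neg_one_pow] at h₂
    constructor <;> linarith

theorem norm_le_mul_norm_ETW_mulVec {a b : ℕ} (ha : 2 < a) (hb : 2 < b) (haodd : Odd a)
    (hbodd : Odd b) (hab : 2 * b < a) (X : Fin (a + b - 1) → ℝ) :
    ‖X‖ ≤ a * ‖(ETW a b).mulVec X‖ := by
  set m := ‖(ETW a b).mulVec X‖ with hm
  have hm0 : 0 ≤ m := norm_nonneg _
  have hab' : 2 * (b : ℝ) ≤ a := by exact_mod_cast hab.le
  obtain ⟨h₁, h₂, h₃, h₄⟩ := (forall_ETW_mulVec_iff ha hb X fun r => |r| ≤ m).1 fun k =>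
    norm_le_pi_norm ((ETW a b).mulVec X) k
  set z := weightedCoord a (a + b - 1) X
  have hz₁ : ∀ i, 1 ≤ i → i ≤ a → 2 * |z i| ≤ a * m := by
    intro i hi hia
    have := two_mul_abs_le_of_odd_cycle (f := fun i => if i = 0 then z a else z i) (m := m) haodd
      (by simp) (fun j hj => by
        rcases Nat.eq_zero_or_pos j with rfl | hj'
        · simpa using h₂
        · simpa [hj'.ne'] using h₁ j hj' hj) hia
    simpa [show i ≠ 0 by omega] using this
  have hz₂ : ∀ i, i < b → 2 * |z (a + i)| ≤ b * m := by
    intro i hi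
    have := two_mul_abs_le_of_odd_cycle (f := fun i => if i = b then z a else z (a + i)) (m := m)
      hbodd (by simp) (fun j hj => by
        rcases Nat.lt_or_ge (j + 1) b with hj' | hj'
        · simpa [hj.ne, hj'.ne, add_assoc] using h₃ (a + j) (by omega) (by omega)
        · obtain rfl : b = j + 1 := by omega
          simpa using h₄) hi.le
    simpa [hi.ne] using this
  refine (pi_norm_le_iff_of_nonneg (by positivity)).2 fun j => ?_
  have hj := weightedCoord_succ a (a + b - 1) X j
  have hbm : 2 * (b * m) ≤ a * m := by nlinarith
  have hbm0 : 0 ≤ b * m := by positivity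
  rw [Real.norm_eq_abs]
  by_cases hja : (j : ℕ) + 1 = a
  · have h := hz₂ 0 (by omega)
    rw [if_pos hja, hja] at hj
    change z a = _ at hj
    rw [add_zero, hj, abs_mul, abs_of_pos (by norm_num : (0 : ℝ) < 4⁻¹)] at h
    linarith
  · rw [if_neg hja] at hj
    change z (j + 1) = _ at hj
    have h : 2 * |z (j + 1)| ≤ a * m := by
      rcases Nat.lt_or_ge a (j + 1) with h | h
      · have := hz₂ (j + 1 - a) (by omega)
        rw [Nat.add_sub_cancel' h.le] at this
        linarith
      · exact hz₁ _ (by omega) h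
    rw [hj, abs_mul, abs_of_pos (by norm_num : (0 : ℝ) < 2⁻¹)] at h
    linarith

section Yvec

variable {p q : ℕ}

theorem Yvec13_of_lt (j : Fin (2 * p + 1 + (2 * q + 1) - 1)) (h : (j : ℕ) + 1 ≤ 2 * p) :
    Yvec13 (2 * p + 1) (2 * q + 1) j =
      (-1) ^ ((j : ℕ) + 1) * (2 * p + 1 - 2 * |(p : ℝ) - ((j : ℕ) + 1)|) := by
  unfold Yvec13
  have h2 : (((2 * p + 1 : ℕ) : ℤ) - 1) / 2 = p := by omega
  simp only [h2, if_pos (show (((j : ℕ) : ℤ) + 1 ≤ ((2 * p + 1 : ℕ) : ℤ) - 1) by omega)]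
  push_cast
  rfl

theorem Yvec13_of_eq (j : Fin (2 * p + 1 + (2 * q + 1) - 1)) (h : (j : ℕ) = 2 * p) :
    Yvec13 (2 * p + 1) (2 * q + 1) j = 2 := by
  unfold Yvec13
  simp only [if_neg (show ¬ (((j : ℕ) : ℤ) + 1 ≤ ((2 * p + 1 : ℕ) : ℤ) - 1) by omega),
    if_pos (show (((j : ℕ) : ℤ) + 1 = ((2 * p + 1 : ℕ) : ℤ)) by omega)]

theorem Yvec13_of_gt (j : Fin (2 * p + 1 + (2 * q + 1) - 1)) (h : 2 * p < (j : ℕ)) :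
    Yvec13 (2 * p + 1) (2 * q + 1) j =
      (-1) ^ ((j : ℕ) + 1) * (2 * q + 1 - 2 * |2 * (p : ℝ) + 1 + (q + 1) - ((j : ℕ) + 1)|) := by
  unfold Yvec13
  have h2 : (((2 * q + 1 : ℕ) : ℤ) + 1) / 2 = q + 1 := by omega
  simp only [h2, if_neg (show ¬ (((j : ℕ) : ℤ) + 1 ≤ ((2 * p + 1 : ℕ) : ℤ) - 1) by omega),
    if_neg (show ¬ (((j : ℕ) : ℤ) + 1 = ((2 * p + 1 : ℕ) : ℤ)) by omega)]
  push_cast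
  rfl

theorem weightedCoord_Yvec13_of_lt {i : ℕ} (hi : 1 ≤ i) (h : i ≤ 2 * p) :
    weightedCoord (2 * p + 1) _ (Yvec13 (2 * p + 1) (2 * q + 1)) i =
      2⁻¹ * ((-1) ^ i * (2 * p + 1 - 2 * |(p : ℝ) - i|)) := by
  obtain ⟨j, rfl⟩ := Nat.exists_eq_add_of_le' hi
  have := weightedCoord_succ (2 * p + 1) _ (Yvec13 (2 * p + 1) (2 * q + 1)) ⟨j, by omega⟩
  rw [Yvec13_of_lt _ h, if_neg (by simp; omega)] at this
  simpa using this

theorem weightedCoord_Yvec13_of_eq :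
    weightedCoord (2 * p + 1) _ (Yvec13 (2 * p + 1) (2 * q + 1)) (2 * p + 1) = 2⁻¹ := by
  have := weightedCoord_succ (2 * p + 1) _ (Yvec13 (2 * p + 1) (2 * q + 1)) ⟨2 * p, by omega⟩
  rw [Yvec13_of_eq _ rfl, if_pos rfl] at this
  rw [this]
  norm_num

theorem weightedCoord_Yvec13_of_gt {i : ℕ} (h : 2 * p + 1 < i) (hi : i ≤ 2 * p + 1 + 2 * q) :
    weightedCoord (2 * p + 1) _ (Yvec13 (2 * p + 1) (2 * q + 1)) i =
      2⁻¹ * ((-1) ^ i * (2 * q + 1 - 2 * |2 * (p : ℝ) + 1 + (q + 1) - i|)) := by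
  obtain ⟨j, rfl⟩ := Nat.exists_eq_add_of_le' (show 1 ≤ i by omega)
  have := weightedCoord_succ (2 * p + 1) _ (Yvec13 (2 * p + 1) (2 * q + 1)) ⟨j, by omega⟩
  rw [Yvec13_of_gt _ (by simpa using h), if_neg (by simp; omega)] at this
  simpa using this

theorem abs_half_alternating_tent_add (c d : ℝ) (i : ℕ) (h : d ≤ i ∨ (i : ℝ) + 1 ≤ d) :
    |2⁻¹ * ((-1) ^ i * (c - 2 * |d - i|)) +
      2⁻¹ * ((-1) ^ (i + 1) * (c - 2 * |d - (i + 1 : ℕ)|))| = 1 := by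
  have key : 2⁻¹ * ((-1 : ℝ) ^ i * (c - 2 * |d - i|)) +
      2⁻¹ * ((-1) ^ (i + 1) * (c - 2 * |d - (i + 1 : ℕ)|)) =
      (-1) ^ i * (|d - (i + 1 : ℕ)| - |d - i|) := by ring
  rw [key, abs_mul, abs_neg_one_pow, one_mul]
  push_cast
  rcases h with h | h
  · rw [abs_of_nonpos (by linarith : d - (i + 1) ≤ 0), abs_of_nonpos (by linarith : d - i ≤ 0)]
    ring_nf
    simp
  · rw [abs_of_nonneg (by linarith : 0 ≤ d - (i + 1)), abs_of_nonneg (by linarith : 0 ≤ d - i)]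
    ring_nf
    simp

theorem abs_ETW_mulVec_Yvec13 (hp : 1 ≤ p) (hq : 1 ≤ q) (k : Fin (2 * p + 1 + (2 * q + 1))) :
    |(ETW (2 * p + 1) (2 * q + 1)).mulVec (Yvec13 (2 * p + 1) (2 * q + 1)) k| = 1 := by
  have hp' : (1 : ℝ) ≤ p := by exact_mod_cast hp
  have hq' : (1 : ℝ) ≤ q := by exact_mod_cast hq
  revert k
  rw [forall_ETW_mulVec_iff (by omega) (by omega) _ fun r => |r| = 1]
  refine ⟨fun i hi hia => ?_, ?_, fun i hi hib => ?_, ?_⟩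
  · rw [weightedCoord_Yvec13_of_lt hi (by omega)]
    rcases Nat.lt_or_ge i (2 * p) with h | h
    · rw [weightedCoord_Yvec13_of_lt (by omega) h]
      refine abs_half_alternating_tent_add _ _ _ ?_
      exact_mod_cast (le_or_gt p i)
    · obtain rfl : i = 2 * p := by omega
      rw [weightedCoord_Yvec13_of_eq, (even_two_mul p).neg_one_pow]
      push_cast
      rw [abs_of_nonpos (by linarith : (p : ℝ) - 2 * p ≤ 0)]
      ring_nf
      simp
  · rw [weightedCoord_Yvec13_of_eq, weightedCoord_Yvec13_of_lt le_rfl (by omega)]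
    push_cast
    rw [abs_of_nonneg (by linarith : (0 : ℝ) ≤ p - 1)]
    ring_nf
    simp
  · rw [weightedCoord_Yvec13_of_gt (i := i + 1) (by omega) (by omega)]
    rcases Nat.lt_or_ge (2 * p + 1) i with h | h
    · rw [weightedCoord_Yvec13_of_gt h (by omega)]
      refine abs_half_alternating_tent_add _ _ _ ?_
      exact_mod_cast (le_or_gt (2 * p + 1 + (q + 1)) i)
    · obtain rfl : i = 2 * p + 1 := by omega
      rw [weightedCoord_Yvec13_of_eq, (show Even (2 * p + 1 + 1) from ⟨p + 1, by ring⟩).neg_one_pow]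
      push_cast
      rw [abs_of_nonneg (by linarith : (0 : ℝ) ≤ 2 * p + 1 + (q + 1) - (2 * p + 1 + 1))]
      ring_nf
      simp
  · rw [weightedCoord_Yvec13_of_eq, weightedCoord_Yvec13_of_gt (by omega) (by omega),
      (show Odd (2 * p + 1 + (2 * q + 1) - 1) from ⟨p + q, by omega⟩).neg_one_pow,
      show 2 * p + 1 + (2 * q + 1) - 1 = 2 * p + 1 + 2 * q by omega]
    push_cast
    rw [abs_of_nonpos (by linarith : 2 * (p : ℝ) + 1 + (q + 1) - (2 * p + 1 + 2 * q) ≤ 0)]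
    ring_nf
    simp

theorem norm_Yvec13 (hp : 1 ≤ p) (hqp : q ≤ p) :
    ‖Yvec13 (2 * p + 1) (2 * q + 1)‖ = 2 * (p : ℝ) + 1 := by
  have hp' : (1 : ℝ) ≤ p := by exact_mod_cast hp
  have hqp' : (q : ℝ) ≤ p := by exact_mod_cast hqp
  apply le_antisymm
  · refine (pi_norm_le_iff_of_nonneg (by positivity)).2 fun j => ?_
    rw [Real.norm_eq_abs]
    rcases lt_trichotomy (j : ℕ) (2 * p) with h | h | h
    · have h₁ : ((j : ℕ) : ℝ) + 1 ≤ 2 * p := by exact_mod_cast h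
      have h₂ : (0 : ℝ) ≤ (j : ℕ) := Nat.cast_nonneg _
      have h₃ : |(p : ℝ) - ((j : ℕ) + 1)| ≤ p := abs_le.2 ⟨by linarith, by linarith⟩
      have h₄ := abs_nonneg ((p : ℝ) - ((j : ℕ) + 1))
      rw [Yvec13_of_lt _ h, abs_mul, abs_neg_one_pow, one_mul, abs_le]
      constructor <;> linarith
    · rw [Yvec13_of_eq _ h, abs_two]
      linarith
    · have h₁ : 2 * (p : ℝ) + 1 ≤ (j : ℕ) := by exact_mod_cast h
      have h₂ : ((j : ℕ) : ℝ) ≤ 2 * p + 2 * q := by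
        have := j.isLt
        exact_mod_cast (by omega : (j : ℕ) ≤ 2 * p + 2 * q)
      have h₃ : |2 * (p : ℝ) + 1 + (q + 1) - ((j : ℕ) + 1)| ≤ q :=
        abs_le.2 ⟨by linarith, by linarith⟩
      have h₄ := abs_nonneg (2 * (p : ℝ) + 1 + (q + 1) - ((j : ℕ) + 1))
      rw [Yvec13_of_gt _ h, abs_mul, abs_neg_one_pow, one_mul, abs_le]
      constructor <;> linarith
  · have hj : p - 1 + 1 = p := by omega
    have h := norm_le_pi_norm (Yvec13 (2 * p + 1) (2 * q + 1)) ⟨p - 1, by omega⟩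
    rw [Yvec13_of_lt _ (show p - 1 + 1 ≤ 2 * p by omega), Real.norm_eq_abs, abs_mul,
      abs_neg_one_pow, one_mul] at h
    have hc : ((p - 1 : ℕ) : ℝ) + 1 = p := by exact_mod_cast hj
    simp only [hc, sub_self, abs_zero, mul_zero, sub_zero] at h
    exact (le_abs_self _).trans h

end Yvec

/-- For `a, b > 2` odd with `a > 2b`, the vector `Y` above satisfies `‖Y‖_∞ = a` and
`‖WY‖_∞ = 1` for the weighted signless incidence matrix `W` of `ET(n, a, b)`, and hence
`μ_∞(ET(n, a, b)) = min_{‖X‖_∞ = 1} ‖WX‖_∞ = 1/a`. -/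
theorem stmt13 (a b : ℕ) (ha : 2 < a) (hb : 2 < b) (haodd : Odd a) (hbodd : Odd b)
    (hab : 2 * b < a) :
    ‖Yvec13 a b‖ = (a : ℝ) ∧ ‖(ETW a b).mulVec (Yvec13 a b)‖ = 1 ∧
    IsLeast {r : ℝ | ∃ X : Fin (a + b - 1) → ℝ, ‖X‖ = 1 ∧ r = ‖(ETW a b).mulVec X‖}
      (1 / (a : ℝ)) := by
  have ha0 : (0 : ℝ) < a := by positivity
  have hY : ‖Yvec13 a b‖ = (a : ℝ) := by
    obtain ⟨p, rfl⟩ := haodd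
    obtain ⟨q, rfl⟩ := hbodd
    rw [norm_Yvec13 (by omega) (by omega)]
    push_cast
    rfl
  have hWY : ‖(ETW a b).mulVec (Yvec13 a b)‖ = 1 := by
    have h : ∀ k, ‖(ETW a b).mulVec (Yvec13 a b) k‖ = 1 := by
      obtain ⟨p, rfl⟩ := haodd
      obtain ⟨q, rfl⟩ := hbodd
      exact abs_ETW_mulVec_Yvec13 (by omega) (by omega)
    refine le_antisymm ((pi_norm_le_iff_of_nonneg zero_le_one).2 fun k => (h k).le) ?_
    exact (h ⟨0, by omega⟩).ge.trans (norm_le_pi_norm _ _)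
  refine ⟨hY, hWY, ⟨(a : ℝ)⁻¹ • Yvec13 a b, ?_, ?_⟩, ?_⟩
  · rw [norm_smul, hY, norm_inv, Real.norm_natCast, inv_mul_cancel₀ ha0.ne']
  · rw [Matrix.mulVec_smul, norm_smul, hWY, norm_inv, Real.norm_natCast, mul_one, one_div]
  · rintro r ⟨X, hX, rfl⟩
    rw [div_le_iff₀' ha0, ← hX]
    exact norm_le_mul_norm_ETW_mulVec ha hb haodd hbodd hab X
end

section
/- Let a, b > 2 be integers with a odd, b even, a > b, and n = a + b − 1. Let W be the weighted signless edge-vertex incidence matrix of ET(n, a, b) and define Y ∈ ℝ^n by: y_i = (−1)^i(a − 2i) for 1 ≤ i ≤ (a−1)/2; y_i = (−1)^{a−i}(a − 2(a−i)) for (a+1)/2 ≤ i ≤ a−1; y_a = 2a; y_i = (−1)^{i−a}(a + 2(i−a)) for a+1 ≤ i ≤ a + b/2; and y_i = (−1)^{a+b−i}(a + 2(a+b−i)) for a + b/2 + 1 ≤ i ≤ a+b−1. Then ‖Y‖_∞ = 2a, ‖WY‖_∞ = 1, and hence μ_∞(ET(n,a,b)) = min_{‖X‖_∞=1} ‖WX‖_∞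 = 1/(2a). -/
/-- The optimal vector `Y` for `ET(n, a, b)` with `a` odd and `b` even:
`y_i = (−1)^i (a − 2i)` for `1 ≤ i ≤ (a−1)/2`; `y_i = (−1)^{a−i} (a − 2(a−i))` for
`(a+1)/2 ≤ i ≤ a−1`; `y_a = 2a`; `y_i = (−1)^{i−a} (a + 2(i−a))` for
`a+1 ≤ i ≤ a + b/2`; and `y_i = (−1)^{a+b−i} (a + 2(a+b−i))` for
`a + b/2 + 1 ≤ i ≤ a+b−1`
(vertex `v_i` corresponds to index `i − 1` in `Fin (a + b - 1)`). -/
noncomputable def YvecEven (a b : ℕ) : Fin (a + b - 1) → ℝ := fun j =>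
  let i : ℕ := (j : ℕ) + 1
  if i ≤ (a - 1) / 2 then (-1 : ℝ) ^ i * ((a : ℝ) - 2 * (i : ℝ))
  else if i ≤ a - 1 then (-1 : ℝ) ^ (a - i) * ((a : ℝ) - 2 * ((a - i : ℕ) : ℝ))
  else if i = a then 2 * (a : ℝ)
  else if i ≤ a + b / 2 then (-1 : ℝ) ^ (i - a) * ((a : ℝ) + 2 * ((i - a : ℕ) : ℝ))
  else (-1 : ℝ) ^ (a + b - i) * ((a : ℝ) + 2 * ((a + b - i : ℕ) : ℝ))

/-- The value `x_i / d_i` at the vertex `v_i` of `ET(n, a, b)` (and `0` if there is no such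
vertex). -/
noncomputable def scaledEntry (a b : ℕ) (X : Fin (a + b - 1) → ℝ) (i : ℕ) : ℝ :=
  if h : i - 1 < a + b - 1 then (if i = a then (4 : ℝ)⁻¹ else (2 : ℝ)⁻¹) * X ⟨i - 1, h⟩ else 0

lemma scaledEntry_succ (a b : ℕ) (X : Fin (a + b - 1) → ℝ) (j : Fin (a + b - 1)) :
    scaledEntry a b X (j + 1) = (if (j : ℕ) + 1 = a then (4 : ℝ)⁻¹ else (2 : ℝ)⁻¹) * X j := by
  simp [scaledEntry]

lemma ETW_mulVec_eq_add {a b : ℕ} (X : Fin (a + b - 1) → ℝ) (k : Fin (a + b)) {u v : ℕ}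
    (hu : 1 ≤ u ∧ u ≤ a + b - 1) (hv : 1 ≤ v ∧ v ≤ a + b - 1) (huv : u ≠ v)
    (h : ∀ j, ETW a b k j =
      if (j : ℕ) + 1 = u ∨ (j : ℕ) + 1 = v then
        (if (j : ℕ) + 1 = a then (4 : ℝ)⁻¹ else (2 : ℝ)⁻¹) else 0) :
    (ETW a b).mulVec X k = scaledEntry a b X u + scaledEntry a b X v := by
  obtain ⟨u, rfl⟩ := Nat.exists_eq_add_of_le' hu.1
  obtain ⟨v, rfl⟩ := Nat.exists_eq_add_of_le' hv.1
  have hu' : u < a + b - 1 := by omega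
  have hv' : v < a + b - 1 := by omega
  have e₁ := scaledEntry_succ a b X ⟨u, hu'⟩
  have e₂ := scaledEntry_succ a b X ⟨v, hv'⟩
  dsimp only at e₁ e₂
  rw [e₁, e₂, Matrix.mulVec, dotProduct, Fintype.sum_eq_add ⟨u, hu'⟩ ⟨v, hv'⟩]
  · simp [h]
  · simpa using huv
  · rintro j ⟨h₁, h₂⟩
    rw [h, if_neg, zero_mul]
    simp only [ne_eq, Fin.ext_iff] at h₁ h₂
    omega

section Rows

variable {a b : ℕ}

lemma ETW_mulVec_of_lt (ha : 2 < a) (hb : 2 < b) (X : Fin (a + b - 1) → ℝ)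
    (k : Fin (a + b)) (hk : (k : ℕ) + 1 < a) :
    (ETW a b).mulVec X k = scaledEntry a b X (k + 1) + scaledEntry a b X (k + 2) := by
  apply ETW_mulVec_eq_add <;> try omega
  intro j
  simp only [ETW]
  rw [if_pos (by omega : (k : ℕ) + 1 ≤ a - 1), if_pos (by omega : (k : ℕ) + 1 ≤ a - 1)]

lemma ETW_mulVec_of_eq (ha : 2 < a) (hb : 2 < b) (X : Fin (a + b - 1) → ℝ)
    (k : Fin (a + b)) (hk : (k : ℕ) + 1 = a) :
    (ETW a b).mulVec X k = scaledEntry a b X a + scaledEntry a b X 1 := by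
  apply ETW_mulVec_eq_add <;> try omega
  intro j
  simp only [ETW]
  rw [if_neg (by omega : ¬ (k : ℕ) + 1 ≤ a - 1), if_neg (by omega : ¬ (k : ℕ) + 1 ≤ a - 1),
    if_pos hk, if_pos hk]

lemma ETW_mulVec_of_le (ha : 2 < a) (X : Fin (a + b - 1) → ℝ)
    (k : Fin (a + b)) (hk : a ≤ k) (hk' : (k : ℕ) + 1 < a + b) :
    (ETW a b).mulVec X k = scaledEntry a b X k + scaledEntry a b X (k + 1) := by
  apply ETW_mulVec_eq_add <;> try omega
  intro j
  simp only [ETW]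
  rw [if_neg (by omega : ¬ (k : ℕ) + 1 ≤ a - 1), if_neg (by omega : ¬ (k : ℕ) + 1 ≤ a - 1),
    if_neg (by omega : ¬ (k : ℕ) + 1 = a), if_neg (by omega : ¬ (k : ℕ) + 1 = a),
    if_pos (by omega : (k : ℕ) + 1 ≤ a + b - 1), if_pos (by omega : (k : ℕ) + 1 ≤ a + b - 1)]
  rfl

lemma ETW_mulVec_last (ha : 2 < a) (hb : 2 < b) (X : Fin (a + b - 1) → ℝ)
    (k : Fin (a + b)) (hk : (k : ℕ) + 1 = a + b) :
    (ETW a b).mulVec X k = scaledEntry a b X k + scaledEntry a b X a := by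
  apply ETW_mulVec_eq_add <;> try omega
  intro j
  simp only [ETW]
  rw [if_neg (by omega : ¬ (k : ℕ) + 1 ≤ a - 1), if_neg (by omega : ¬ (k : ℕ) + 1 ≤ a - 1),
    if_neg (by omega : ¬ (k : ℕ) + 1 = a), if_neg (by omega : ¬ (k : ℕ) + 1 = a),
    if_neg (by omega : ¬ (k : ℕ) + 1 ≤ a + b - 1), if_neg (by omega : ¬ (k : ℕ) + 1 ≤ a + b - 1)]
  simp only [show (k : ℕ) = a + b - 1 by omega]

end Rows

lemma abs_sub_alternating_le {f : ℕ → ℝ} {r : ℝ} {N : ℕ}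
    (h : ∀ d < N, |f d + f (d + 1)| ≤ r) (i j : ℕ) (hij : i + j ≤ N) :
    |f i - (-1) ^ j * f (i + j)| ≤ j * r := by
  induction j with
  | zero => simp
  | succ j ih =>
    have h₁ := ih (by omega)
    have h₂ := h (i + j) (by omega)
    have h₃ : |(-1) ^ j * (f (i + j) + f (i + j + 1))| ≤ r := by
      simpa [abs_mul, abs_pow] using h₂
    have h₄ := abs_add_le (f i - (-1) ^ j * f (i + j)) ((-1) ^ j * (f (i + j) + f (i + j + 1)))
    have h₅ : f i - (-1) ^ (j + 1) * f (i + (j + 1)) =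
        f i - (-1) ^ j * f (i + j) + (-1) ^ j * (f (i + j) + f (i + j + 1)) := by
      rw [← add_assoc]; ring
    rw [h₅]
    push_cast
    linarith

/-- Along an odd closed walk, every value is at most `N / 2` times the largest edge sum. -/
lemma two_mul_abs_le_of_odd_cycle_s15 {f : ℕ → ℝ} {r : ℝ} {N : ℕ} (hN : Odd N) (h0 : f 0 = f N)
    (h : ∀ d < N, |f d + f (d + 1)| ≤ r) {i : ℕ} (hi : i ≤ N) : 2 * |f i| ≤ N * r := by
  obtain ⟨j, rfl⟩ := Nat.exists_eq_add_of_le hi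
  have h₁ := abs_sub_alternating_le h 0 i (by omega)
  have h₂ := abs_sub_alternating_le h i j le_rfl
  have hp : (-1 : ℝ) ^ i * (-1) ^ j = -1 := by rw [← pow_add, hN.neg_one_pow]
  rw [zero_add, h0] at h₁
  push_cast
  rcases neg_one_pow_eq_or ℝ i with hi | hi <;> rw [hi] at h₁ hp
  · have hj : (-1 : ℝ) ^ j = -1 := by linarith
    rw [hj] at h₂
    rw [abs_le] at h₁ h₂
    rcases abs_cases (f i) with h | h <;> linarith
  · have hj : (-1 : ℝ) ^ j = 1 := by linarith
    rw [hj] at h₂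
    rw [abs_le] at h₁ h₂
    rcases abs_cases (f i) with h | h <;> linarith

/-- Along any closed walk, the values exceed the one at the base point by at most `N / 2` times
the largest edge sum. -/
lemma two_mul_abs_le_of_cycle {f : ℕ → ℝ} {r : ℝ} {N : ℕ} (h0 : f 0 = f N)
    (h : ∀ d < N, |f d + f (d + 1)| ≤ r) {i : ℕ} (hi : i ≤ N) :
    2 * |f i| ≤ 2 * |f 0| + N * r := by
  obtain ⟨j, rfl⟩ := Nat.exists_eq_add_of_le hi
  have h₁ := abs_sub_alternating_le h 0 i (by omega)
  have h₂ := abs_sub_alternating_le h i j le_rfl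
  have h₃ := abs_sub_abs_le_abs_sub ((-1) ^ i * f i) (f 0)
  have h₄ := abs_sub_abs_le_abs_sub (f i) ((-1) ^ j * f (i + j))
  rw [zero_add, abs_sub_comm] at h₁
  simp only [abs_mul, abs_pow, abs_neg, abs_one, one_pow, one_mul] at h₃ h₄
  rw [← h0] at h₂ h₄
  push_cast
  linarith

lemma two_mul_abs_scaledEntry_le {a b : ℕ} (ha : 2 < a) (hb : 2 < b) (haodd : Odd a)
    (X : Fin (a + b - 1) → ℝ) {i : ℕ} (hi : 1 ≤ i) (hia : i ≤ a) :
    2 * |scaledEntry a b X i| ≤ a * ‖(ETW a b).mulVec X‖ := by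
  have key := two_mul_abs_le_of_odd_cycle_s15 (r := ‖(ETW a b).mulVec X‖)
    (f := fun d => if d = 0 then scaledEntry a b X a else scaledEntry a b X d) haodd
    (by simp) ?_ hia
  · simpa [show i ≠ 0 by omega] using key
  · rintro (_ | d) hd
    · have := norm_le_pi_norm ((ETW a b).mulVec X) ⟨a - 1, by omega⟩
      rw [ETW_mulVec_of_eq ha hb X ⟨a - 1, by omega⟩ (by dsimp only; omega)] at this
      simpa using this
    · have := norm_le_pi_norm ((ETW a b).mulVec X) ⟨d, by omega⟩
      rw [ETW_mulVec_of_lt ha hb X ⟨d, by omega⟩ hd] at this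
      simpa using this

lemma two_mul_abs_scaledEntry_add_le {a b : ℕ} (ha : 2 < a) (hb : 2 < b) (haodd : Odd a)
    (X : Fin (a + b - 1) → ℝ) {d : ℕ} (hd : d < b) :
    2 * |scaledEntry a b X (a + d)| ≤ (a + b) * ‖(ETW a b).mulVec X‖ := by
  have h0 := two_mul_abs_scaledEntry_le ha hb haodd X (by omega) le_rfl
  have key := two_mul_abs_le_of_cycle (r := ‖(ETW a b).mulVec X‖)
    (f := fun d => if d = b then scaledEntry a b X a else scaledEntry a b X (a + d))
    (N := b) (by simp) ?_ hd.le
  · simp only [show d ≠ b by omega, show 0 ≠ b by omega, if_false, add_zero] at key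
    linarith
  · intro d hd
    have := norm_le_pi_norm ((ETW a b).mulVec X) ⟨a + d, by omega⟩
    rcases eq_or_ne (d + 1) b with h | h
    · rw [ETW_mulVec_last ha hb X ⟨a + d, by omega⟩ (by dsimp only; omega)] at this
      simpa [h, hd.ne] using this
    · rw [ETW_mulVec_of_le ha X ⟨a + d, by omega⟩ (by simp) (by dsimp only; omega)] at this
      simpa [h, hd.ne, add_assoc] using this

/-- The lower bound `‖X‖ ≤ 2a ‖WX‖` for the odd cycle longer than the other one. -/
lemma norm_le_two_mul_norm_ETW_mulVec {a b : ℕ} (ha : 2 < a) (hb : 2 < b) (haodd : Odd a)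
    (hba : b < a) (X : Fin (a + b - 1) → ℝ) : ‖X‖ ≤ 2 * a * ‖(ETW a b).mulVec X‖ := by
  have hr := norm_nonneg ((ETW a b).mulVec X)
  have har : 0 ≤ a * ‖(ETW a b).mulVec X‖ := by positivity
  have hbr : b * ‖(ETW a b).mulVec X‖ ≤ a * ‖(ETW a b).mulVec X‖ := by gcongr
  rw [pi_norm_le_iff_of_nonneg (by positivity)]
  intro j
  have hs := scaledEntry_succ a b X j
  rw [Real.norm_eq_abs]
  rcases lt_trichotomy ((j : ℕ) + 1) a with h | h | h
  · have := two_mul_abs_scaledEntry_le ha hb haodd X (by omega : 1 ≤ (j : ℕ) + 1) h.le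
    rw [hs, if_neg h.ne, abs_mul, abs_of_pos (by norm_num)] at this
    linarith
  · have := two_mul_abs_scaledEntry_le ha hb haodd X (by omega : 1 ≤ (j : ℕ) + 1) h.le
    rw [hs, if_pos h, abs_mul, abs_of_pos (by norm_num)] at this
    linarith
  · have := two_mul_abs_scaledEntry_add_le ha hb haodd X (d := j + 1 - a) (by omega)
    rw [show a + ((j : ℕ) + 1 - a) = j + 1 by omega, hs, if_neg h.ne', abs_mul,
      abs_of_pos (by norm_num)] at this
    linarith

section OptimalVector

variable {a b : ℕ}

lemma scaledEntry_YvecEven_near (hb : 2 < b) {i : ℕ} (hi : 1 ≤ i) (h : i ≤ (a - 1) / 2) :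
    scaledEntry a b (YvecEven a b) i = (-1) ^ i * ((a : ℝ) / 2 - i) := by
  obtain ⟨i, rfl⟩ := Nat.exists_eq_add_of_le' hi
  rw [scaledEntry_succ a b _ ⟨i, by omega⟩]
  simp only [YvecEven]
  rw [if_neg (by omega), if_pos h]
  ring

lemma scaledEntry_YvecEven_far (hb : 2 < b) {d : ℕ} (hd : 1 ≤ d) (hda : d < a)
    (h : (a - 1) / 2 < a - d) :
    scaledEntry a b (YvecEven a b) (a - d) = (-1) ^ d * ((a : ℝ) / 2 - d) := by
  obtain ⟨i, hi⟩ := Nat.exists_eq_add_of_le' (by omega : 1 ≤ a - d)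
  rw [hi, scaledEntry_succ a b _ ⟨i, by omega⟩]
  simp only [YvecEven]
  rw [if_neg (by omega), if_neg (by omega), if_pos (by omega), show a - (i + 1) = d by omega]
  ring

lemma YvecEven_center (ha : 2 < a) (hb : 2 < b) :
    YvecEven a b ⟨a - 1, by omega⟩ = 2 * a := by
  simp only [YvecEven]
  rw [if_neg (by omega), if_neg (by omega), if_pos (by omega)]

lemma scaledEntry_YvecEven_center (ha : 2 < a) (hb : 2 < b) :
    scaledEntry a b (YvecEven a b) a = (a : ℝ) / 2 := by
  rw [scaledEntry, dif_pos (by omega), if_pos rfl, YvecEven_center ha hb]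
  ring

lemma scaledEntry_YvecEven_add (ha : 2 < a) (hb : 2 < b) {d : ℕ} (h : d ≤ b / 2) :
    scaledEntry a b (YvecEven a b) (a + d) = (-1) ^ d * ((a : ℝ) / 2 + d) := by
  rcases Nat.eq_zero_or_pos d with rfl | hd
  · simpa using scaledEntry_YvecEven_center ha hb
  obtain ⟨i, hi⟩ := Nat.exists_eq_add_of_le' (by omega : 1 ≤ a + d)
  rw [hi, scaledEntry_succ a b _ ⟨i, by omega⟩]
  simp only [YvecEven]
  rw [if_neg (by omega), if_neg (by omega), if_neg (by omega), if_neg (by omega),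
    if_pos (by omega), show i + 1 - a = d by omega]
  ring

lemma scaledEntry_YvecEven_sub (ha : 2 < a) {d : ℕ} (hd : 1 ≤ d) (h : b / 2 < b - d) :
    scaledEntry a b (YvecEven a b) (a + b - d) = (-1) ^ d * ((a : ℝ) / 2 + d) := by
  obtain ⟨i, hi⟩ := Nat.exists_eq_add_of_le' (by omega : 1 ≤ a + b - d)
  rw [hi, scaledEntry_succ a b _ ⟨i, by omega⟩]
  simp only [YvecEven]
  rw [if_neg (by omega), if_neg (by omega), if_neg (by omega), if_neg (by omega),
    if_neg (by omega), show a + b - (i + 1) = d by omega]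
  ring

lemma abs_neg_one_pow_mul_add_le {d : ℕ} {x y : ℝ} (h : |x - y| ≤ 1) :
    |(-1) ^ d * x + (-1) ^ (d + 1) * y| ≤ 1 := by
  rw [show (-1) ^ d * x + (-1) ^ (d + 1) * y = (-1) ^ d * (x - y) by ring]
  simpa [abs_mul, abs_pow] using h

lemma norm_ETW_mulVec_YvecEven_le (ha : 2 < a) (hb : 2 < b) (haodd : Odd a) (hbeven : Even b) :
    ‖(ETW a b).mulVec (YvecEven a b)‖ ≤ 1 := by
  rw [pi_norm_le_iff_of_nonneg zero_le_one]
  rintro ⟨k, hk⟩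
  obtain ⟨m, hm⟩ := haodd
  obtain ⟨c, hc⟩ := hbeven
  rw [Real.norm_eq_abs]
  rcases lt_trichotomy (k + 1) a with h | h | h
  · rw [ETW_mulVec_of_lt ha hb _ ⟨k, hk⟩ h]
    dsimp only
    rcases lt_trichotomy (k + 1) m with h' | h' | h'
    · rw [scaledEntry_YvecEven_near hb (by omega) (by omega),
        scaledEntry_YvecEven_near hb (by omega) (by omega)]
      apply abs_neg_one_pow_mul_add_le
      push_cast
      ring_nf
      norm_num
    · have hfar := scaledEntry_YvecEven_far (a := a) hb (d := m) (by omega) (by omega) (by omega)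
      rw [show a - m = k + 2 by omega] at hfar
      rw [hfar, scaledEntry_YvecEven_near hb (by omega) (by omega), h', hm]
      push_cast
      rw [show (-1 : ℝ) ^ m * ((2 * m + 1) / 2 - m) + (-1) ^ m * ((2 * m + 1) / 2 - m)
        = (-1) ^ m by ring]
      simp
    · obtain ⟨d, hd⟩ : ∃ d, a = k + 2 + d := ⟨a - (k + 2), by omega⟩
      have h₁ := scaledEntry_YvecEven_far (a := a) hb (d := d + 1) (by omega) (by omega) (by omega)
      rw [show a - (d + 1) = k + 1 by omega] at h₁
      have h₂ : scaledEntry a b (YvecEven a b) (k + 2) = (-1) ^ d * ((a : ℝ) / 2 - d) := by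
        rcases Nat.eq_zero_or_pos d with rfl | hd'
        · rw [show k + 2 = a by omega, scaledEntry_YvecEven_center ha hb]
          simp
        · have := scaledEntry_YvecEven_far (a := a) hb (d := d) hd' (by omega) (by omega)
          rwa [show a - d = k + 2 by omega] at this
      rw [h₁, h₂, add_comm]
      apply abs_neg_one_pow_mul_add_le
      push_cast
      ring_nf
      norm_num
  · rw [ETW_mulVec_of_eq ha hb _ ⟨k, hk⟩ h, scaledEntry_YvecEven_center ha hb,
      scaledEntry_YvecEven_near hb le_rfl (by omega)]
    ring_nf
    norm_num
  · obtain ⟨d, rfl⟩ := Nat.exists_eq_add_of_le (by omega : a ≤ k)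
    by_cases hd : d + 1 ≤ c
    · rw [ETW_mulVec_of_le ha _ ⟨a + d, hk⟩ (by simp) (by dsimp only; omega)]
      dsimp only
      rw [add_assoc, scaledEntry_YvecEven_add ha hb (by omega),
        scaledEntry_YvecEven_add ha hb (by omega)]
      apply abs_neg_one_pow_mul_add_le
      push_cast
      ring_nf
      norm_num
    · obtain ⟨e, he⟩ : ∃ e, b = d + 1 + e := ⟨b - (d + 1), by omega⟩
      have h₁ : scaledEntry a b (YvecEven a b) (a + d) =
          (-1) ^ (e + 1) * ((a : ℝ) / 2 + (e + 1 : ℕ)) := by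
        rcases eq_or_ne d c with hdc | hdc
        · rw [scaledEntry_YvecEven_add ha hb (by omega), show e + 1 = d by omega]
        · have := scaledEntry_YvecEven_sub (b := b) ha (d := e + 1) (by omega) (by omega)
          rwa [show a + b - (e + 1) = a + d by omega] at this
      rcases Nat.eq_zero_or_pos e with rfl | he'
      · rw [ETW_mulVec_last ha hb _ ⟨a + d, hk⟩ (by dsimp only; omega), h₁,
          scaledEntry_YvecEven_center ha hb]
        push_cast
        ring_nf
        norm_num
      · have h₂ := scaledEntry_YvecEven_sub (b := b) ha (d := e) he' (by omega)
        rw [show a + b - e = a + d + 1 by omega] at h₂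
        rw [ETW_mulVec_of_le ha _ ⟨a + d, hk⟩ (by simp) (by dsimp only; omega)]
        dsimp only
        rw [h₁, h₂, add_comm]
        apply abs_neg_one_pow_mul_add_le
        push_cast
        ring_nf
        norm_num

end OptimalVector

/-- For `a, b > 2` with `a` odd, `b` even and `a > b`, the vector `Y` above satisfies
`‖Y‖_∞ = 2a` and `‖WY‖_∞ = 1` for the weighted signless incidence matrix `W` of
`ET(n, a, b)`, and hence `μ_∞(ET(n, a, b)) = min_{‖X‖_∞ = 1} ‖WX‖_∞ = 1/(2a)`. -/
theorem stmt15 (a b : ℕ) (ha : 2 < a) (hb : 2 < b) (haodd : Odd a) (hbeven : Even b)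
    (hba : b < a) :
    ‖YvecEven a b‖ = 2 * (a : ℝ) ∧ ‖(ETW a b).mulVec (YvecEven a b)‖ = 1 ∧
    IsLeast {r : ℝ | ∃ X : Fin (a + b - 1) → ℝ, ‖X‖ = 1 ∧ r = ‖(ETW a b).mulVec X‖}
      (1 / (2 * (a : ℝ))) := by
  have ha0 : (0 : ℝ) < 2 * a := by positivity
  have hle := norm_ETW_mulVec_YvecEven_le ha hb haodd hbeven
  have hlow := norm_le_two_mul_norm_ETW_mulVec ha hb haodd hba (YvecEven a b)
  have hcenter := norm_le_pi_norm (YvecEven a b) ⟨a - 1, by omega⟩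
  rw [YvecEven_center ha hb, Real.norm_eq_abs, abs_of_pos ha0] at hcenter
  have hW : ‖(ETW a b).mulVec (YvecEven a b)‖ = 1 := by
    refine le_antisymm hle (le_of_mul_le_mul_left ?_ ha0)
    linarith
  have hY : ‖YvecEven a b‖ = 2 * (a : ℝ) := by
    rw [hW, mul_one] at hlow
    exact le_antisymm hlow hcenter
  refine ⟨hY, hW, ⟨(1 / (2 * (a : ℝ))) • YvecEven a b, ?_, ?_⟩, ?_⟩
  · rw [norm_smul, hY, Real.norm_of_nonneg (by positivity)]
    field_simp
  · rw [Matrix.mulVec_smul, norm_smul, hW, Real.norm_of_nonneg (by positivity), mul_one]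
  · rintro r ⟨X, hX, rfl⟩
    rw [div_le_iff₀' ha0, ← hX]
    exact norm_le_two_mul_norm_ETW_mulVec ha hb haodd hba X
end
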